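/- arXiv:2205.11794 — 8 statements merged into one kernel-verified Lean document; each statement's English description precedes it below -/
import Mathlib

section
/- Let c > 0, 0 < p ≤ 1, D > 0, q > 0, C₁ > 0, and set γ(t) = c/(c+t), β(t) = (c/(c+t))^p. Suppose v : [1,∞) → ℝⁿ is continuously differentiable, the improper integral ∫_t^∞ γ(τ)·v(τ) dτ converges for every t ≥ 1, and: (i) ‖v(t)‖₂ ≤ D for all t ≥ 1; (ii) ‖v'(t)‖₂ ≤ β(t)·D for all t ≥ 1; (iii) (1/2)·‖∫_t^∞ γ(τ)·v(τ) dτ‖₂² ≤ C₁/t^q for all t ≥ 1. Then there exists a constant C > 0 such that ‖v(t)‖₂² ≤ C·t^{−(q/2 + p − 1)} for all t ≥ 1. -/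
open MeasureTheory

/-- A vector `x` that stays `δ`-close to `v` on `[a, b]` is controlled by the weighted integral of
`v`, provided the weight is bounded below by `m > 0`. -/
theorem norm_le_of_norm_weighted_integral_le {E : Type*} [NormedAddCommGroup E] [NormedSpace ℝ E]
    [CompleteSpace E] {w : ℝ → ℝ} {v : ℝ → E} {x : E} {a b m δ ε : ℝ} (hab : a < b) (hm : 0 < m)
    (hw : ContinuousOn w (Set.Icc a b)) (hv : ContinuousOn v (Set.Icc a b))
    (hwm : ∀ τ ∈ Set.Icc a b, m ≤ w τ) (hδ : ∀ τ ∈ Set.Icc a b, ‖x - v τ‖ ≤ δ)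
    (hε : ‖∫ τ in a..b, w τ • v τ‖ ≤ ε) :
    ‖x‖ ≤ δ + ε / ((b - a) * m) := by
  have huIcc : Set.uIcc a b = Set.Icc a b := Set.uIcc_of_le hab.le
  have hwi : IntervalIntegrable w volume a b :=
    ContinuousOn.intervalIntegrable (by rwa [huIcc])
  have hwvi : IntervalIntegrable (fun τ => w τ • v τ) volume a b :=
    ContinuousOn.intervalIntegrable (by rw [huIcc]; exact hw.smul hv)
  have hwxi : IntervalIntegrable (fun τ => w τ • x) volume a b :=
    ContinuousOn.intervalIntegrable (by rw [huIcc]; exact hw.smul continuousOn_const)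
  have hW : (b - a) * m ≤ ∫ τ in a..b, w τ := by
    have h := intervalIntegral.integral_mono_on hab.le intervalIntegrable_const hwi hwm
    simpa using h
  set W := ∫ τ in a..b, w τ with hWdef
  have hpos : 0 < (b - a) * m := mul_pos (sub_pos.2 hab) hm
  have hWpos : 0 < W := hpos.trans_le hW
  have hdiff : ‖∫ τ in a..b, w τ • (x - v τ)‖ ≤ W * δ := by
    rw [hWdef, ← intervalIntegral.integral_mul_const]
    refine intervalIntegral.norm_integral_le_of_norm_le hab.le
      (Filter.Eventually.of_forall fun τ hτ => ?_) (hwi.mul_const δ)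
    have hτ' := Set.Ioc_subset_Icc_self hτ
    have hwτ : 0 ≤ w τ := hm.le.trans (hwm τ hτ')
    rw [norm_smul, Real.norm_of_nonneg hwτ]
    exact mul_le_mul_of_nonneg_left (hδ τ hτ') hwτ
  have hsplit : W • x = (∫ τ in a..b, w τ • (x - v τ)) + ∫ τ in a..b, w τ • v τ := by
    simp_rw [smul_sub]
    rw [intervalIntegral.integral_sub hwxi hwvi, sub_add_cancel,
      intervalIntegral.integral_smul_const]
  have hWx : W * ‖x‖ ≤ W * δ + ε := by
    rw [← Real.norm_of_nonneg hWpos.le, ← norm_smul, Real.norm_of_nonneg hWpos.le, hsplit]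
    exact (norm_add_le _ _).trans (add_le_add hdiff hε)
  have hε0 : 0 ≤ ε := (norm_nonneg _).trans hε
  calc ‖x‖ ≤ δ + ε / W := by
        rw [← sub_le_iff_le_add', le_div_iff₀ hWpos]
        linarith
    _ ≤ δ + ε / ((b - a) * m) := by gcongr

/-- Continuous averaging lemma: a bounded trajectory `v` with velocity decaying
like `β(t) D = (c/(c+t))^p D` and tail averages (weighted by `γ(t) = c/(c+t)`)
decaying like `C₁/t^q` satisfies `‖v t‖² ≤ C t^{-(q/2+p-1)}`. -/
theorem continuous_averaging_lemma (n : ℕ) (c p D q C₁ : ℝ) (hc : 0 < c)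
    (hp0 : 0 < p) (hp1 : p ≤ 1) (hD : 0 < D) (hq : 0 < q) (hC₁ : 0 < C₁)
    (v v' : ℝ → EuclideanSpace ℝ (Fin n))
    (hderiv : ∀ t ≥ (1:ℝ), HasDerivAt v (v' t) t)
    (hcont : ContinuousOn v' (Set.Ici (1:ℝ)))
    (hint : ∀ t ≥ (1:ℝ),
      IntegrableOn (fun τ => (c / (c + τ)) • v τ) (Set.Ioi t))
    (hbd : ∀ t ≥ (1:ℝ), ‖v t‖ ≤ D)
    (hvel : ∀ t ≥ (1:ℝ), ‖v' t‖ ≤ (c / (c + t)) ^ p * D)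
    (htail : ∀ t ≥ (1:ℝ),
      (1/2) * ‖∫ τ in Set.Ioi t, (c / (c + τ)) • v τ‖ ^ 2 ≤ C₁ / t ^ q) :
    ∃ C > 0, ∀ t ≥ (1:ℝ), ‖v t‖ ^ 2 ≤ C * t ^ (-(q / 2 + p - 1)) := by
  set s : ℝ := (1 + p - q / 2) / 2 with hs
  set K : ℝ := √(2 * C₁) with hK
  have hKpos : 0 < K := Real.sqrt_pos.2 (by positivity)
  set A : ℝ := c ^ p * D + 2 * K * ((c + 2) / c) with hA
  have hApos : 0 < A := by positivity
  refine ⟨A ^ 2, by positivity, fun t ht => ?_⟩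
  have ht0 : 0 < t := by linarith
  have hγcont : ContinuousOn (fun τ : ℝ => c / (c + τ)) (Set.Ici 1) :=
    continuousOn_const.div (by fun_prop) fun τ hτ => by
      have : (1 : ℝ) ≤ τ := hτ
      positivity
  have hvcont : ContinuousOn v (Set.Ici 1) := fun τ hτ =>
    (hderiv τ hτ).continuousAt.continuousWithinAt
  have htail' : ∀ u ≥ t, ‖∫ τ in Set.Ioi u, (c / (c + τ)) • v τ‖ ≤ K * t ^ (-(q / 2)) := by
    intro u hu
    have hsq : (K * t ^ (-(q / 2))) ^ 2 = 2 * C₁ / t ^ q := by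
      rw [mul_pow, hK, Real.sq_sqrt (by positivity), ← Real.rpow_mul_natCast ht0.le,
        div_eq_mul_inv _ (t ^ q), ← Real.rpow_neg ht0.le]
      congr 2
      push_cast
      ring
    refine le_of_sq_le_sq ?_ (by positivity)
    have h1 := htail u (ht.trans hu)
    have h2 : C₁ / u ^ q ≤ C₁ / t ^ q := by gcongr
    rw [hsq, mul_div_assoc]
    linarith
  set h : ℝ := t ^ s with hh
  have hpos : 0 < h := Real.rpow_pos_of_pos ht0 s
  have hle : h ≤ t := by
    simpa using Real.rpow_le_rpow_of_exponent_le ht (show s ≤ 1 by rw [hs]; linarith)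
  have hsub : Set.Icc t (t + h) ⊆ Set.Ici 1 := fun τ hτ => ht.trans hτ.1
  have hinterval : ‖∫ τ in t..(t + h), (c / (c + τ)) • v τ‖ ≤ 2 * K * t ^ (-(q / 2)) := by
    rw [← intervalIntegral.integral_Ioi_sub_Ioi (hint t ht) (by linarith)]
    have h1 := htail' t le_rfl
    have h2 := htail' (t + h) (by linarith)
    exact (norm_sub_le _ _).trans (by linarith)
  have hvar : ∀ τ ∈ Set.Icc t (t + h), ‖v t - v τ‖ ≤ c ^ p * D * t ^ (-p) * h := by
    intro τ hτ
    have hmv := (convex_Icc t (t + h)).norm_image_sub_le_of_norm_hasDerivWithin_le (f := v)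
      (f' := v') (C := c ^ p * D * t ^ (-p))
      (fun σ hσ => (hderiv σ (hsub hσ)).hasDerivWithinAt) (fun σ hσ => ?_)
      hτ (Set.left_mem_Icc.2 (by linarith))
    · refine hmv.trans (mul_le_mul_of_nonneg_left ?_ (by positivity))
      rw [Real.norm_eq_abs, abs_le]
      constructor <;> linarith [hτ.1, hτ.2]
    · have htσ : t ≤ σ := hσ.1
      have hσ0 : 0 < σ := ht0.trans_le htσ
      calc ‖v' σ‖ ≤ (c / (c + σ)) ^ p * D := hvel σ (hsub hσ)
        _ ≤ (c / t) ^ p * D := by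
          have : 0 ≤ c / (c + σ) := by positivity
          gcongr
          linarith
        _ = c ^ p * D * t ^ (-p) := by
          rw [Real.div_rpow hc.le ht0.le, Real.rpow_neg ht0.le]
          ring
  have hweight : ∀ τ ∈ Set.Icc t (t + h), c / ((c + 2) * t) ≤ c / (c + τ) := by
    intro τ hτ
    have hτ1 : 1 ≤ τ := hsub hτ
    have : c ≤ c * t := le_mul_of_one_le_right hc.le ht
    gcongr
    linarith [hτ.2]
  have hnorm : ‖v t‖ ≤ A * t ^ ((1 - p - q / 2) / 2) := by
    have hmain := norm_le_of_norm_weighted_integral_le (m := c / ((c + 2) * t))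
      (lt_add_of_pos_right t hpos) (by positivity)
      (hγcont.mono hsub) (hvcont.mono hsub) hweight hvar hinterval
    have e1 : t ^ (-p) * h = t ^ ((1 - p - q / 2) / 2) := by
      rw [hh, ← Real.rpow_add ht0]
      congr 1
      rw [hs]
      ring
    have e2 : t ^ (-(q / 2)) * t / h = t ^ ((1 - p - q / 2) / 2) := by
      rw [hh, ← Real.rpow_add_one ht0.ne', ← Real.rpow_sub ht0]
      congr 1
      rw [hs]
      ring
    refine hmain.trans_eq ?_
    calc _ = c ^ p * D * (t ^ (-p) * h) +
          2 * K * ((c + 2) / c) * (t ^ (-(q / 2)) * t / h) := by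
          rw [add_sub_cancel_left]
          field_simp
      _ = _ := by rw [e1, e2, hA]; ring
  calc ‖v t‖ ^ 2 ≤ (A * t ^ ((1 - p - q / 2) / 2)) ^ 2 := by gcongr
    _ = A ^ 2 * t ^ (-(q / 2 + p - 1)) := by
      rw [mul_pow, ← Real.rpow_mul_natCast ht0.le]
      congr 2
      push_cast
      ring
end

section
/- Let D ⊂ ℝⁿ be a compact convex set, let f : ℝⁿ → ℝ be differentiable and μ-strongly convex with μ > 0, and let x* be the minimizer of f over D. Let c > 0, 0 < p ≤ 1, γ(t) = c/(c+t), β(t) = (c/(c+t))^p with β(t) ≥ γ(t) for all t ≥ 1, and let x, s̄ : [1,∞) → ℝⁿ be continuously differentiable curves with values in D satisfying s̄'(t) = β(t)·(s(t) − s̄(t)) and x'(t) = γ(t)·(s̄(t) − x(t)), where s(t) ∈ argmin_{s∈D} ⟨∇f(x(t)), s⟩ for every t. Suppose x(t) → x* as t → ∞ and there exist C₀ > 0 and q > 0 with f(x(t)) − f(x*) ≤ C₀·t^{−q} for all t ≥ 1. Then there exists C > 0 such that ‖s̄(t) − x(t)‖₂² ≤ C·t^{−(q/2 + p − 1)} for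 all t ≥ 1. -/
open RealInnerProductSpace

/-- Quadratic growth of a strongly convex function around its minimizer on a convex set. -/
theorem norm_sub_sq_le_of_strongly_convex {E : Type*} [NormedAddCommGroup E]
    [InnerProductSpace ℝ E] {D : Set E} (hD : Convex ℝ D) {f : E → ℝ} {f' : E → E} {μ : ℝ}
    (hμ : 0 < μ) (hsc : ∀ z w, f w ≥ f z + ⟪f' z, w - z⟫ + μ / 2 * ‖w - z‖ ^ 2)
    {a y : E} (ha : a ∈ D) (hmin : ∀ z ∈ D, f a ≤ f z) (hy : y ∈ D) :
    ‖y - a‖ ^ 2 ≤ 4 / μ * (f y - f a) := by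
  set m : E := (1 / 2 : ℝ) • a + (1 / 2 : ℝ) • y with hm
  have hmD : m ∈ D := hD ha hy (by norm_num) (by norm_num) (by norm_num)
  have hym : y - m = (1 / 2 : ℝ) • (y - a) := by rw [hm]; module
  have ham : a - m = -((1 / 2 : ℝ) • (y - a)) := by rw [hm]; module
  have h1 := hsc m y
  have h2 := hsc m a
  rw [hym, norm_smul, mul_pow] at h1
  rw [ham, inner_neg_right, norm_neg, norm_smul, mul_pow] at h2
  norm_num at h1 h2
  have h3 := hmin m hmD
  rw [div_mul_eq_mul_div, le_div_iff₀ hμ]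
  linarith

/-- A Landau-type interpolation inequality: if `x' = c / (c + τ) • u`, then the size of `u` is
controlled by the size of `x - a` and of `u'` on `[t, t + h]`. -/
theorem mul_norm_le_of_hasDerivAt_smul {E : Type*} [NormedAddCommGroup E] [NormedSpace ℝ E]
    {c t h K B : ℝ} (hc : 0 < c) (ht : 0 < t) (hh : 0 < h) (hK : 0 ≤ K)
    {x u u' : ℝ → E} {a : E}
    (hx : ∀ τ ∈ Set.Icc t (t + h), HasDerivAt x ((c / (c + τ)) • u τ) τ)
    (hu : ∀ τ ∈ Set.Icc t (t + h), HasDerivAt u (u' τ) τ)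
    (hu' : ∀ τ ∈ Set.Icc t (t + h), ‖u' τ‖ ≤ K)
    (hB : ∀ τ ∈ Set.Icc t (t + h), ‖x τ - a‖ ≤ B) :
    c * h * ‖u t‖ ≤ c * K * h ^ 2 + 2 * (c + t + h) * B := by
  have htl : t ∈ Set.Icc t (t + h) := Set.left_mem_Icc.2 (by linarith)
  have htr : t + h ∈ Set.Icc t (t + h) := Set.right_mem_Icc.2 (by linarith)
  have hosc : ∀ τ ∈ Set.Icc t (t + h), ‖u τ - u t‖ ≤ K * h := by
    intro τ hτ
    refine ((convex_Icc t (t + h)).norm_image_sub_le_of_norm_hasDerivWithin_le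
      (fun r hr => (hu r hr).hasDerivWithinAt) hu' htl hτ).trans ?_
    rw [Real.norm_of_nonneg (by linarith [hτ.1])]
    exact mul_le_mul_of_nonneg_left (by linarith [hτ.2]) hK
  have hg : ∀ τ ∈ Set.Icc t (t + h),
      HasDerivAt (fun r => (c + r) • (x r - a) - (c * (r - t)) • u t)
        ((x τ - a) + c • (u τ - u t)) τ := by
    intro τ hτ
    have hcτ : c + τ ≠ 0 := by linarith [hτ.1]
    have h1 := ((hasDerivAt_id τ).const_add c).smul ((hx τ hτ).sub_const a)
    have h2 := (((hasDerivAt_id τ).sub_const t).const_mul c).smul_const (u t)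
    refine (h1.sub h2).congr_deriv ?_
    rw [smul_smul, id, mul_div_cancel₀ _ hcτ]
    module
  have hmv := (convex_Icc t (t + h)).norm_image_sub_le_of_norm_hasDerivWithin_le
    (C := B + c * (K * h)) (fun r hr => (hg r hr).hasDerivWithinAt)
    (fun r hr => (norm_add_le _ _).trans (by
      rw [norm_smul, Real.norm_of_nonneg hc.le]
      exact add_le_add (hB r hr) (mul_le_mul_of_nonneg_left (hosc r hr) hc.le))) htl htr
  simp only [add_sub_cancel_left, sub_self, mul_zero, zero_smul, sub_zero] at hmv
  rw [Real.norm_of_nonneg hh.le] at hmv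
  have hnorm : c * h * ‖u t‖ = ‖(c * h) • u t‖ := by
    rw [norm_smul, Real.norm_of_nonneg (by positivity)]
  have hdecomp : (c * h) • u t = (c + (t + h)) • (x (t + h) - a) - (c + t) • (x t - a)
      - ((c + (t + h)) • (x (t + h) - a) - (c * h) • u t - (c + t) • (x t - a)) := by
    abel
  have htri : ‖(c * h) • u t‖ ≤ (c + (t + h)) * B + (c + t) * B + (B + c * (K * h)) * h := by
    rw [hdecomp]
    refine (norm_sub_le _ _).trans (add_le_add ((norm_sub_le _ _).trans ?_) hmv)
    rw [norm_smul, norm_smul, Real.norm_of_nonneg (by positivity : 0 ≤ c + (t + h)),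
      Real.norm_of_nonneg (by positivity : 0 ≤ c + t)]
    gcongr
    · exact hB _ htr
    · exact hB _ htl
  rw [hnorm]
  linarith

/-- Discretization-error decay for the averaged Frank-Wolfe flow: under
`μ`-strong convexity and the rate `f(x(t)) - f(x*) ≤ C₀ t^{-q}`, the term
`‖s̄(t) - x(t)‖²` decays like `t^{-(q/2+p-1)}`. -/
theorem avgfw_flow_discretization_decay (n : ℕ) (c p q C₀ μ : ℝ) (hc : 0 < c)
    (hp0 : 0 < p) (hp1 : p ≤ 1) (hq : 0 < q) (hC₀ : 0 < C₀) (hμ : 0 < μ)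
    (D : Set (EuclideanSpace ℝ (Fin n))) (hDcomp : IsCompact D) (hDconv : Convex ℝ D)
    (f : EuclideanSpace ℝ (Fin n) → ℝ)
    (f' : EuclideanSpace ℝ (Fin n) → EuclideanSpace ℝ (Fin n))
    (hgrad : ∀ z, HasGradientAt f (f' z) z)
    (hsc : ∀ z w, f w ≥ f z + ⟪f' z, w - z⟫ + μ / 2 * ‖w - z‖ ^ 2)
    (xstar : EuclideanSpace ℝ (Fin n)) (hxs : xstar ∈ D)
    (hxsmin : ∀ y ∈ D, f xstar ≤ f y)
    (hβγ : ∀ t ≥ (1:ℝ), (c / (c + t)) ^ p ≥ c / (c + t))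
    (x sbar s : ℝ → EuclideanSpace ℝ (Fin n))
    (hxD : ∀ t ≥ (1:ℝ), x t ∈ D) (hsbarD : ∀ t ≥ (1:ℝ), sbar t ∈ D)
    (hsD : ∀ t ≥ (1:ℝ), s t ∈ D)
    (hlmo : ∀ t ≥ (1:ℝ), ∀ y ∈ D, ⟪f' (x t), s t⟫ ≤ ⟪f' (x t), y⟫)
    (hsbar' : ∀ t ≥ (1:ℝ), HasDerivAt sbar (((c / (c + t)) ^ p) • (s t - sbar t)) t)
    (hx' : ∀ t ≥ (1:ℝ), HasDerivAt x ((c / (c + t)) • (sbar t - x t)) t)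
    (hlim : Filter.Tendsto x Filter.atTop (nhds xstar))
    (hrate : ∀ t ≥ (1:ℝ), f (x t) - f xstar ≤ C₀ * t ^ (-q)) :
    ∃ C > 0, ∀ t ≥ (1:ℝ), ‖sbar t - x t‖ ^ 2 ≤ C * t ^ (-(q / 2 + p - 1)) := by
  obtain ⟨M, hM⟩ := hDcomp.isBounded.exists_norm_le
  have hM0 : 0 ≤ M := (norm_nonneg _).trans (hM _ hxs)
  have hdiam : ∀ y ∈ D, ∀ z ∈ D, ‖y - z‖ ≤ 2 * M := fun y hy z hz =>
    (norm_sub_le _ _).trans (by linarith [hM y hy, hM z hz])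
  set A : ℝ := Real.sqrt (4 / μ * C₀) with hA
  have hA2 : A ^ 2 = 4 / μ * C₀ := Real.sq_sqrt (by positivity)
  have hApos : 0 < A := Real.sqrt_pos.2 (by positivity)
  have herr : ∀ t ≥ (1 : ℝ), ‖x t - xstar‖ ≤ A * t ^ (-(q / 2)) := by
    intro t ht
    have ht0 : 0 < t := by linarith
    refine (sq_le_sq₀ (norm_nonneg _) (by positivity)).1 ?_
    rw [mul_pow, hA2, ← Real.rpow_mul_natCast ht0.le]
    refine (norm_sub_sq_le_of_strongly_convex hDconv hμ hsc hxs hxsmin (hxD t ht)).trans ?_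
    rw [mul_assoc]
    refine mul_le_mul_of_nonneg_left ((hrate t ht).trans_eq ?_) (by positivity)
    congr 2
    push_cast
    ring
  set L : ℝ := 4 * M * c ^ p + 2 * (c + 2) * A / c with hL
  have hLpos : 0 < L := by positivity
  refine ⟨L ^ 2, by positivity, fun t ht => ?_⟩
  have ht0 : 0 < t := by linarith
  set h : ℝ := t ^ ((1 - q / 2 + p) / 2) with hh
  have hhpos : 0 < h := by positivity
  have hht : h ≤ t := by
    refine (Real.rpow_le_rpow_of_exponent_le ht (?_ : _ ≤ (1 : ℝ))).trans_eq (Real.rpow_one t)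
    linarith
  have hu' : ∀ τ ∈ Set.Icc t (t + h),
      ‖((c / (c + τ)) ^ p) • (s τ - sbar τ) - (c / (c + τ)) • (sbar τ - x τ)‖
        ≤ 4 * M * (c ^ p * t ^ (-p)) := by
    intro τ hτ
    have hτ1 : 1 ≤ τ := ht.trans hτ.1
    have hτ0 : 0 < τ := by linarith
    have hβ : (c / (c + τ)) ^ p ≤ c ^ p * t ^ (-p) := by
      rw [Real.rpow_neg ht0.le, ← div_eq_mul_inv, ← Real.div_rpow hc.le ht0.le]
      gcongr
      linarith [hτ.1]
    have hγ := (hβγ τ hτ1).trans hβ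
    refine (norm_sub_le _ _).trans ?_
    rw [norm_smul, norm_smul, Real.norm_of_nonneg (by positivity),
      Real.norm_of_nonneg (by positivity)]
    have h1 := mul_le_mul hβ (hdiam _ (hsD τ hτ1) _ (hsbarD τ hτ1)) (norm_nonneg _)
      (by positivity)
    have h2 := mul_le_mul hγ (hdiam _ (hsbarD τ hτ1) _ (hxD τ hτ1)) (norm_nonneg _)
      (by positivity)
    linarith
  have hkey := mul_norm_le_of_hasDerivAt_smul (u := fun τ => sbar τ - x τ) (a := xstar)
    (B := A * t ^ (-(q / 2))) hc ht0 hhpos (by positivity)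
    (fun τ hτ => hx' τ (ht.trans hτ.1))
    (fun τ hτ => (hsbar' τ (ht.trans hτ.1)).sub (hx' τ (ht.trans hτ.1))) hu'
    (fun τ hτ => (herr τ (ht.trans hτ.1)).trans (mul_le_mul_of_nonneg_left
      (Real.rpow_le_rpow_of_nonpos ht0 hτ.1 (by linarith)) hApos.le))
  set w : ℝ := t ^ (-((q / 2 + p - 1) / 2)) with hw
  have hhp : h * t ^ (-p) = w := by
    rw [hh, hw, ← Real.rpow_add ht0]
    ring_nf
  have hhw : t * t ^ (-(q / 2)) = h * w := by
    nth_rewrite 1 [← Real.rpow_one t]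
    rw [hh, hw, ← Real.rpow_add ht0, ← Real.rpow_add ht0]
    ring_nf
  have hcoef : 2 * (c + t + h) ≤ 2 * (c + 2) * t := by nlinarith
  have hbound : c * h * ‖sbar t - x t‖ ≤ c * h * (L * w) := by
    refine hkey.trans ?_
    have h1 := mul_le_mul_of_nonneg_right hcoef
      (by positivity : 0 ≤ A * t ^ (-(q / 2)))
    have h2 : c * (4 * M * (c ^ p * t ^ (-p))) * h ^ 2 = c * h * (4 * M * c ^ p * w) := by
      rw [← hhp]; ring
    have h3 : 2 * (c + 2) * t * (A * t ^ (-(q / 2))) = c * h * (2 * (c + 2) * A / c * w) := by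
      calc _ = 2 * (c + 2) * A * (t * t ^ (-(q / 2))) := by ring
        _ = _ := by rw [hhw]; field_simp
    have h4 : c * h * (L * w)
        = c * h * (4 * M * c ^ p * w) + c * h * (2 * (c + 2) * A / c * w) := by
      rw [hL]; ring
    rw [h2, h4, ← h3]
    linarith
  have hle := le_of_mul_le_mul_left hbound (by positivity)
  calc ‖sbar t - x t‖ ^ 2 ≤ (L * w) ^ 2 := by gcongr
    _ = L ^ 2 * t ^ (-(q / 2 + p - 1)) := by
      rw [mul_pow, hw, ← Real.rpow_mul_natCast ht0.le]
      push_cast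
      ring_nf
end

section
/- Let c > 0, 0 < p ≤ 1, D > 0, q > 0, C₁ > 0, and set γ_k = c/(c+k), β_k = (c/(c+k))^p. Suppose (v_k)_{k≥1} is a sequence in ℝⁿ such that the series Σ_{i≥1} γ_i·v_i converges and: (i) ‖v_k‖₂ ≤ D for all k ≥ 1; (ii) ‖v_{k+1} − v_k‖₂ ≤ β_k·D for all k ≥ 1; (iii) (1/2)·‖Σ_{i=k}^∞ γ_i·v_i‖₂² ≤ C₁/k^q for all k ≥ 1. Then there exists a constant C > 0 such that ‖v_k‖₂² ≤ C·k^{−min(q/2 + p − 1, 2p)} for all k ≥ 1. -/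
lemma norm_add_sub_le_mul_of_step_le {E : Type*} [SeminormedAddCommGroup E] {u : ℕ → E} {k : ℕ}
    {b : ℝ} (h : ∀ i, k ≤ i → ‖u (i + 1) - u i‖ ≤ b) (j : ℕ) : ‖u (k + j) - u k‖ ≤ j * b := by
  induction j with
  | zero => simp
  | succ j ih =>
    calc ‖u (k + (j + 1)) - u k‖ = ‖(u (k + j + 1) - u (k + j)) + (u (k + j) - u k)‖ := by
          rw [sub_add_sub_cancel, add_assoc]
      _ ≤ b + j * b := (norm_add_le _ _).trans (add_le_add (h _ (Nat.le_add_right k j)) ih)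
      _ = (j + 1 : ℕ) * b := by push_cast; ring

lemma card_mul_norm_le_norm_sum_smul {ι E : Type*} [NormedAddCommGroup E] [InnerProductSpace ℝ E]
    {s : Finset ι} {w : ι → ℝ} {u : ι → E} {x : E} {g : ℝ} (hg : 0 ≤ g) (hw : ∀ j ∈ s, g ≤ w j)
    (hu : ∀ j ∈ s, ‖u j - x‖ ≤ ‖x‖ / 2) :
    s.card * (g * (‖x‖ / 2)) ≤ ‖∑ j ∈ s, w j • u j‖ := by
  rcases eq_or_ne x 0 with rfl | hx
  · simp
  refine le_of_mul_le_mul_right ?_ (norm_pos_iff.mpr hx)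
  have key : ∀ j ∈ s, g * (‖x‖ / 2) * ‖x‖ ≤ inner ℝ (w j • u j) x := by
    intro j hj
    have h1 : |inner ℝ (u j - x) x| ≤ ‖x‖ / 2 * ‖x‖ :=
      (abs_real_inner_le_norm _ _).trans (by gcongr; exact hu j hj)
    rw [inner_sub_left, real_inner_self_eq_norm_sq] at h1
    have h2 : ‖x‖ / 2 * ‖x‖ ≤ inner ℝ (u j) x := by nlinarith [neg_le_of_abs_le h1]
    rw [real_inner_smul_left, mul_assoc]
    exact mul_le_mul (hw j hj) h2 (by positivity) (hg.trans (hw j hj))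
  calc s.card * (g * (‖x‖ / 2)) * ‖x‖ = ∑ j ∈ s, g * (‖x‖ / 2) * ‖x‖ := by
        rw [Finset.sum_const, nsmul_eq_mul]; ring
    _ ≤ ∑ j ∈ s, inner ℝ (w j • u j) x := Finset.sum_le_sum key
    _ = inner ℝ (∑ j ∈ s, w j • u j) x := (sum_inner _ _ _).symm
    _ ≤ ‖∑ j ∈ s, w j • u j‖ * ‖x‖ := real_inner_le_norm _ _

lemma Summable.sum_range_add_eq_tsum_sub_tsum {E : Type*} [AddCommGroup E] [TopologicalSpace E]
    [IsTopologicalAddGroup E] [T2Space E] {f : ℕ → E} (hf : Summable f) (k M : ℕ) :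
    ∑ j ∈ Finset.range M, f (k + j) = ∑' i, f (k + i) - ∑' i, f (k + M + i) := by
  have hk : Summable fun i => f (k + i) := by
    simpa only [add_comm] using (summable_nat_add_iff k).mpr hf
  rw [eq_sub_iff_add_eq, ← hk.sum_add_tsum_nat_add M]
  simp only [add_assoc, add_comm M]


/-- Discrete averaging lemma: a bounded sequence `v_k` with successive
differences decaying like `β_k D = (c/(c+k))^p D` and tail sums (weighted by
`γ_k = c/(c+k)`) decaying like `C₁/k^q` satisfies
`‖v_k‖² ≤ C k^{-min(q/2+p-1, 2p)}`. -/
theorem discrete_averaging_lemma (n : ℕ) (c p D q C₁ : ℝ) (hc : 0 < c)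
    (hp0 : 0 < p) (hp1 : p ≤ 1) (hD : 0 < D) (hq : 0 < q) (hC₁ : 0 < C₁)
    (v : ℕ → EuclideanSpace ℝ (Fin n))
    (hsum : Summable (fun i : ℕ => (c / (c + (i : ℝ))) • v i))
    (hbd : ∀ k : ℕ, 1 ≤ k → ‖v k‖ ≤ D)
    (hvel : ∀ k : ℕ, 1 ≤ k →
      ‖v (k + 1) - v k‖ ≤ (c / (c + (k : ℝ))) ^ p * D)
    (htail : ∀ k : ℕ, 1 ≤ k →
      (1/2) * ‖∑' i : ℕ, (c / (c + ((k + i : ℕ) : ℝ))) • v (k + i)‖ ^ 2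
        ≤ C₁ / (k : ℝ) ^ q) :
    ∃ C > 0, ∀ k : ℕ, 1 ≤ k →
      ‖v k‖ ^ 2 ≤ C * (k : ℝ) ^ (-(min (q / 2 + p - 1) (2 * p))) := by
  have hB : 0 < √(2 * C₁) := by positivity
  have hT : ∀ k : ℕ, 1 ≤ k →
      ‖∑' i : ℕ, (c / (c + ((k + i : ℕ) : ℝ))) • v (k + i)‖ ≤
        √(2 * C₁) * (k : ℝ) ^ (-(q / 2)) := by
    intro k hk
    refine (sq_le_sq₀ (norm_nonneg _) (by positivity)).mp ?_
    have h := htail k hk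
    have hsq : ((k : ℝ) ^ (-(q / 2))) ^ 2 = ((k : ℝ) ^ q)⁻¹ := by
      rw [← Real.rpow_natCast, ← Real.rpow_mul k.cast_nonneg, ← Real.rpow_neg k.cast_nonneg]
      congr 1; push_cast; ring
    rw [mul_pow, Real.sq_sqrt (by positivity), hsq]
    rw [div_eq_mul_inv C₁] at h
    linarith
  refine ⟨8 * √(2 * C₁) * (c ^ p * D) * ((c + 1) * (2 * c + 1) / (2 * c ^ 2)), by positivity, ?_⟩
  intro k hk
  have hx : (1 : ℝ) ≤ k := by exact_mod_cast hk
  have hx0 : (0 : ℝ) < k := by linarith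
  set b : ℝ := (c / (c + k)) ^ p * D with hb
  have hb0 : 0 < b := by positivity
  set M : ℕ := ⌊‖v k‖ / (2 * b)⌋₊ + 1 with hM
  have hMlow : ‖v k‖ / (2 * b) ≤ M := by
    rw [hM]; push_cast; exact (Nat.lt_floor_add_one _).le
  have hj : ∀ j ∈ Finset.range M, (j : ℝ) ≤ ‖v k‖ / (2 * b) := fun j hj =>
    (Nat.cast_le.mpr (Nat.lt_succ_iff.mp (Finset.mem_range.mp hj))).trans
      (Nat.floor_le (by positivity))
  have hstep : ∀ i, k ≤ i → ‖v (i + 1) - v i‖ ≤ b := fun i hi =>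
    (hvel i (hk.trans hi)).trans (by rw [hb]; gcongr)
  have hu : ∀ j ∈ Finset.range M, ‖v (k + j) - v k‖ ≤ ‖v k‖ / 2 := by
    intro j hjM
    refine (norm_add_sub_le_mul_of_step_le hstep j).trans ?_
    calc (j : ℝ) * b ≤ ‖v k‖ / (2 * b) * b := by gcongr; exact hj j hjM
      _ = ‖v k‖ / 2 := by field_simp
  have hwin : ‖v k‖ / (2 * b) ≤ (c + k) / (2 * c) := by
    have hbase : c / (c + k) ≤ (c / (c + k)) ^ p := by
      refine Real.self_le_rpow_of_le_one (by positivity) ?_ hp1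
      rw [div_le_one (by positivity)]; linarith
    calc ‖v k‖ / (2 * b) ≤ D / (2 * (c / (c + k) * D)) := by
          gcongr
          · exact hbd k hk
          · rw [hb]; gcongr
      _ = (c + k) / (2 * c) := by field_simp
  set g : ℝ := 2 * c ^ 2 / ((c + k) * (2 * c + 1)) with hg
  have hg0 : 0 < g := by positivity
  have hw : ∀ j ∈ Finset.range M, g ≤ c / (c + ((k + j : ℕ) : ℝ)) := by
    intro j hjM
    have h1 := (hj j hjM).trans hwin
    rw [le_div_iff₀ (by positivity)] at h1
    rw [hg, div_le_div_iff₀ (by positivity) (by positivity)]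
    push_cast
    nlinarith [mul_le_mul_of_nonneg_left h1 hc.le]
  have hlow := card_mul_norm_le_norm_sum_smul hg0.le hw hu
  rw [Finset.card_range, hsum.sum_range_add_eq_tsum_sub_tsum k M] at hlow
  have hup : ‖v k‖ / (2 * b) * (g * (‖v k‖ / 2)) ≤ 2 * √(2 * C₁) * (k : ℝ) ^ (-(q / 2)) := by
    have hmono : ((k + M : ℕ) : ℝ) ^ (-(q / 2)) ≤ (k : ℝ) ^ (-(q / 2)) :=
      Real.rpow_le_rpow_of_nonpos hx0 (by push_cast; linarith [M.cast_nonneg (α := ℝ)])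
        (by linarith)
    have h1 := (hlow.trans (norm_sub_le _ _)).trans
      (add_le_add (hT k hk) (hT (k + M) (hk.trans (Nat.le_add_right k M))))
    have h2 : ‖v k‖ / (2 * b) * (g * (‖v k‖ / 2)) ≤ M * (g * (‖v k‖ / 2)) := by gcongr
    linarith [mul_le_mul_of_nonneg_left hmono hB.le]
  have hbup : b ≤ c ^ p * D * (k : ℝ) ^ (-p) := by
    calc b ≤ (c / k) ^ p * D := by rw [hb]; gcongr; linarith
      _ = c ^ p * D * (k : ℝ) ^ (-p) := by
        rw [Real.div_rpow hc.le hx0.le, Real.rpow_neg hx0.le]; ring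
  have hgup : 1 / g ≤ (c + 1) * (2 * c + 1) / (2 * c ^ 2) * k := by
    rw [hg, one_div_div, div_mul_eq_mul_div]
    gcongr ?_ / _
    nlinarith [mul_nonneg (mul_nonneg hc.le (sub_nonneg.mpr hx)) (by linarith : 0 ≤ 2 * c + 1)]
  calc ‖v k‖ ^ 2 = 4 * b * (1 / g) * (‖v k‖ / (2 * b) * (g * (‖v k‖ / 2))) := by
        field_simp; ring
    _ ≤ 4 * (c ^ p * D * (k : ℝ) ^ (-p)) * ((c + 1) * (2 * c + 1) / (2 * c ^ 2) * k) *
          (2 * √(2 * C₁) * (k : ℝ) ^ (-(q / 2))) := by gcongr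
    _ = 8 * √(2 * C₁) * (c ^ p * D) * ((c + 1) * (2 * c + 1) / (2 * c ^ 2)) *
          (k : ℝ) ^ (-(q / 2 + p - 1)) := by
        rw [show -(q / 2 + p - 1) = -p + 1 + -(q / 2) by ring, Real.rpow_add hx0,
          Real.rpow_add hx0, Real.rpow_one]
        ring
    _ ≤ _ := by
        gcongr
        exact min_le_left _ _
end

section
/- Let D ⊂ ℝⁿ be a compact convex set, let f : ℝⁿ → ℝ be differentiable and μ-strongly convex with μ > 0, and let x* be the minimizer of f over D. Let c > 0, 0 < p ≤ 1, γ_k = c/(c+k), β_k = (c/(c+k))^p with β_k ≥ γ_k for all k ≥ 1, and let (x_k), (s̄_k) be sequences in D generated by the averaged Frank-Wolfe method: s_k ∈ argmin_{s∈D} ⟨∇f(x_k), s⟩, s̄_k = s̄_{k−1} + β_k(s_k − s̄_{k−1}), x_{k+1} = x_k + γ_k(s̄_k − x_k). Suppose x_k → x* and there exist C₀ > 0 and q > 0 with f(x_k) − f(x*) ≤ C₀·k^{−q} for all k ≥ 1. Then there exists C > 0 such that ‖s̄_k − x_k‖₂² ≤ C·max(k^{−(q/2 + p − 1)}, k^{−2p})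 for all k ≥ 1. -/
open RealInnerProductSpace

/-- Quadratic growth away from a minimizer over a convex set, under strong convexity. -/
lemma quadratic_growth_of_strong_convexity {E : Type*} [NormedAddCommGroup E]
    [InnerProductSpace ℝ E] {D : Set E} (hD : Convex ℝ D) {f : E → ℝ} {f' : E → E} {μ : ℝ}
    (hsc : ∀ z w, f w ≥ f z + ⟪f' z, w - z⟫ + μ / 2 * ‖w - z‖ ^ 2)
    {a y : E} (ha : a ∈ D) (hmin : ∀ z ∈ D, f a ≤ f z) (hy : y ∈ D) :
    μ / 4 * ‖y - a‖ ^ 2 ≤ f y - f a := by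
  set z : E := midpoint ℝ a y with hz
  have hzD : z ∈ D := hD.midpoint_mem ha hy
  have hyz : y - z = (1 / 2 : ℝ) • (y - a) := by
    rw [hz, midpoint_eq_smul_add, invOf_eq_inv]; module
  have haz : a - z = -((1 / 2 : ℝ) • (y - a)) := by
    rw [hz, midpoint_eq_smul_add, invOf_eq_inv]; module
  have h₁ := hsc z y
  have h₂ := hsc z a
  rw [hyz, norm_smul] at h₁
  rw [haz, inner_neg_right, norm_neg, norm_smul] at h₂
  norm_num at h₁ h₂
  have h₃ := hmin z hzD
  linarith

/-- If a direction varies slowly, the iterates driven by it must travel far. -/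
lemma displacement_of_slowly_varying_direction {E : Type*} [NormedAddCommGroup E]
    [InnerProductSpace ℝ E] {x d : ℕ → E} {γ : ℕ → ℝ} {k m : ℕ} {a g : ℝ}
    (hx : ∀ j, k ≤ j → x (j + 1) = x j + γ j • d j)
    (hd : ∀ j, k ≤ j → ‖d (j + 1) - d j‖ ≤ a) (ha : 0 ≤ a) (hm : m * a ≤ ‖d k‖ / 2)
    (hg : 0 ≤ g) (hγ : ∀ j, k ≤ j → j < k + m → g ≤ γ j) :
    m * g * (‖d k‖ / 2) ≤ ‖x (k + m) - x k‖ := by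
  have hdist : ∀ j : ℕ, ‖d (k + j) - d k‖ ≤ j * a := by
    intro j
    induction j with
    | zero => simp
    | succ j ih =>
      have h := norm_sub_le_norm_sub_add_norm_sub (d (k + (j + 1))) (d (k + j)) (d k)
      have h' := hd (k + j) (by omega)
      rw [← add_assoc] at h ⊢
      push_cast
      linarith
  have hinner : ∀ j : ℕ, j ≤ m → ‖d k‖ ^ 2 / 2 ≤ ⟪d (k + j), d k⟫ := by
    intro j hj
    have h₁ : ‖d (k + j) - d k‖ ≤ ‖d k‖ / 2 :=
      (hdist j).trans ((mul_le_mul_of_nonneg_right (by exact_mod_cast hj) ha).trans hm)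
    have h₂ := (abs_le.mp (abs_real_inner_le_norm (d (k + j) - d k) (d k))).1
    rw [inner_sub_left, real_inner_self_eq_norm_sq] at h₂
    nlinarith [mul_le_mul_of_nonneg_right h₁ (norm_nonneg (d k))]
  have hsum : ∀ j : ℕ, j ≤ m → j * g * (‖d k‖ ^ 2 / 2) ≤ ⟪x (k + j) - x k, d k⟫ := by
    intro j
    induction j with
    | zero => simp
    | succ j ih =>
      intro hj
      have h₁ := ih (by omega)
      have h₂ := hinner j (by omega)
      have h₃ := hγ (k + j) (by omega) (by omega)
      have h₄ : g * (‖d k‖ ^ 2 / 2) ≤ γ (k + j) * ⟪d (k + j), d k⟫ :=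
        mul_le_mul h₃ h₂ (by positivity) (hg.trans h₃)
      rw [← add_assoc, hx (k + j) (by omega), add_sub_right_comm, inner_add_left,
        real_inner_smul_left]
      push_cast
      linarith
  have h := (hsum m le_rfl).trans (real_inner_le_norm _ _)
  rcases (norm_nonneg (d k)).eq_or_lt with h0 | h0
  · simp [← h0]
  · refine le_of_mul_le_mul_right ?_ h0
    linarith

/-- Discretization-error decay for the averaged Frank-Wolfe method: under
`μ`-strong convexity and the rate `f(x_k) - f(x*) ≤ C₀ k^{-q}`, the term
`‖s̄_k - x_k‖²` decays like `max(k^{-(q/2+p-1)}, k^{-2p})`. -/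
theorem avgfw_method_discretization_decay (n : ℕ) (c p q C₀ μ : ℝ) (hc : 0 < c)
    (hp0 : 0 < p) (hp1 : p ≤ 1) (hq : 0 < q) (hC₀ : 0 < C₀) (hμ : 0 < μ)
    (D : Set (EuclideanSpace ℝ (Fin n))) (hDcomp : IsCompact D) (hDconv : Convex ℝ D)
    (f : EuclideanSpace ℝ (Fin n) → ℝ)
    (f' : EuclideanSpace ℝ (Fin n) → EuclideanSpace ℝ (Fin n))
    (hgrad : ∀ z, HasGradientAt f (f' z) z)
    (hsc : ∀ z w, f w ≥ f z + ⟪f' z, w - z⟫ + μ / 2 * ‖w - z‖ ^ 2)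
    (xstar : EuclideanSpace ℝ (Fin n)) (hxs : xstar ∈ D)
    (hxsmin : ∀ y ∈ D, f xstar ≤ f y)
    (hβγ : ∀ k : ℕ, 1 ≤ k → (c / (c + (k : ℝ))) ^ p ≥ c / (c + (k : ℝ)))
    (x sbar s : ℕ → EuclideanSpace ℝ (Fin n))
    (hxD : ∀ k, x k ∈ D) (hsbarD : ∀ k, sbar k ∈ D) (hsD : ∀ k, s k ∈ D)
    (hlmo : ∀ k : ℕ, 1 ≤ k → ∀ y ∈ D, ⟪f' (x k), s k⟫ ≤ ⟪f' (x k), y⟫)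
    (hsbar : ∀ k : ℕ, 1 ≤ k →
      sbar k = sbar (k - 1) + ((c / (c + (k : ℝ))) ^ p) • (s k - sbar (k - 1)))
    (hx : ∀ k : ℕ, 1 ≤ k →
      x (k + 1) = x k + (c / (c + (k : ℝ))) • (sbar k - x k))
    (hlim : Filter.Tendsto x Filter.atTop (nhds xstar))
    (hrate : ∀ k : ℕ, 1 ≤ k → f (x k) - f xstar ≤ C₀ * (k : ℝ) ^ (-q)) :
    ∃ C > 0, ∀ k : ℕ, 1 ≤ k →
      ‖sbar k - x k‖ ^ 2
        ≤ C * max ((k : ℝ) ^ (-(q / 2 + p - 1))) ((k : ℝ) ^ (-(2 * p))) := by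
  obtain ⟨B, hB⟩ := hDcomp.isBounded.exists_norm_le
  have hB0 : 0 ≤ B := (norm_nonneg _).trans (hB _ hxs)
  have hdiff : ∀ y ∈ D, ∀ z ∈ D, ‖y - z‖ ≤ 2 * B := fun y hy z hz =>
    (norm_sub_le y z).trans (by linarith [hB y hy, hB z hz])
  set A : ℝ := (4 * B + 1) * c ^ p with hA
  have hcp : 0 < c ^ p := Real.rpow_pos_of_pos hc p
  have hA0 : 0 < A := by positivity
  set R : ℝ := Real.sqrt (4 * C₀ / μ) with hR
  set M : ℝ := B / A with hM
  have hM0 : 0 ≤ M := by positivity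
  have hdist : ∀ k : ℕ, 1 ≤ k → ‖x k - xstar‖ ≤ R * (k : ℝ) ^ (-(q / 2)) := by
    intro k hk
    have h₁ := quadratic_growth_of_strong_convexity hDconv hsc hxs hxsmin (hxD k)
    have h₂ := h₁.trans (hrate k hk)
    refine le_of_sq_le_sq ?_ (by positivity)
    have h₃ : ((k : ℝ) ^ (-(q / 2))) ^ 2 = (k : ℝ) ^ (-q) := by
      rw [← Real.rpow_mul_natCast (by positivity)]; congr 1; push_cast; ring
    rw [mul_pow, h₃, hR, Real.sq_sqrt (by positivity), div_mul_eq_mul_div, le_div_iff₀ hμ]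
    linarith
  refine ⟨4 * A ^ 2 + 16 * R * A * (c + 1 + M) / c, by positivity, fun k hk => ?_⟩
  have hk1 : (1 : ℝ) ≤ k := by exact_mod_cast hk
  have hk0 : (0 : ℝ) < k := by linarith
  set d : ℕ → EuclideanSpace ℝ (Fin n) := fun j => sbar j - x j with hd
  have hd2 : ∀ j, ‖d j‖ ≤ 2 * B := fun j => hdiff _ (hsbarD j) _ (hxD j)
  set a : ℝ := A * (k : ℝ) ^ (-p) with ha
  have ha0 : 0 < a := by positivity
  have hβ : ∀ j : ℕ, k ≤ j → (c / (c + (j : ℝ))) ^ p ≤ c ^ p * (k : ℝ) ^ (-p) := by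
    intro j hj
    have hj' : (k : ℝ) ≤ j := by exact_mod_cast hj
    rw [Real.rpow_neg hk0.le, ← div_eq_mul_inv, ← Real.div_rpow hc.le hk0.le]
    exact Real.rpow_le_rpow (by positivity) (by gcongr; linarith) hp0.le
  have hstep : ∀ j, k ≤ j → ‖d (j + 1) - d j‖ ≤ a := by
    intro j hj
    have h₁ := hsbar (j + 1) (by omega)
    rw [Nat.add_sub_cancel] at h₁
    have h₂ : d (j + 1) - d j = ((c / (c + ((j + 1 : ℕ) : ℝ))) ^ p) • (s (j + 1) - sbar j)
        - (c / (c + (j : ℝ))) • (sbar j - x j) := by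
      simp only [hd]
      rw [hx j (by omega), h₁]
      abel
    have h₃ := hβ j hj
    have h₄ := hβ (j + 1) (by omega)
    have h₅ := hβγ j (by omega)
    have h₆ : 0 ≤ c ^ p * (k : ℝ) ^ (-p) := by positivity
    calc ‖d (j + 1) - d j‖
        ≤ (c / (c + ((j + 1 : ℕ) : ℝ))) ^ p * ‖s (j + 1) - sbar j‖
          + c / (c + (j : ℝ)) * ‖sbar j - x j‖ := by
          rw [h₂]
          refine (norm_sub_le _ _).trans_eq ?_
          rw [norm_smul, norm_smul, Real.norm_of_nonneg (by positivity),
            Real.norm_of_nonneg (by positivity)]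
      _ ≤ c ^ p * (k : ℝ) ^ (-p) * (2 * B) + c ^ p * (k : ℝ) ^ (-p) * (2 * B) := by
          gcongr
          · exact hdiff _ (hsD _) _ (hsbarD _)
          · exact h₅.trans h₃
          · exact hd2 j
      _ ≤ a := by
          rw [ha, hA]
          linarith
  change ‖d k‖ ^ 2 ≤ _
  by_cases hsmall : ‖d k‖ < 2 * a
  · have h₁ : a ^ 2 = A ^ 2 * (k : ℝ) ^ (-(2 * p)) := by
      rw [ha, mul_pow, ← Real.rpow_mul_natCast hk0.le]
      congr 2; push_cast; ring
    calc ‖d k‖ ^ 2 ≤ (2 * a) ^ 2 := by gcongr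
      _ = 4 * A ^ 2 * (k : ℝ) ^ (-(2 * p)) := by rw [mul_pow, h₁]; ring
      _ ≤ _ := by
        gcongr
        · exact le_add_of_nonneg_right (by positivity)
        · exact le_max_right _ _
  · push Not at hsmall
    have hone : 1 ≤ ‖d k‖ / (2 * a) := (one_le_div (by positivity)).2 hsmall
    set m : ℕ := ⌊‖d k‖ / (2 * a)⌋₊ with hm
    have hm_le : (m : ℝ) ≤ ‖d k‖ / (2 * a) := Nat.floor_le (by positivity)
    have hm_ge : ‖d k‖ / (4 * a) ≤ m := by
      have h₁ : (1 : ℝ) ≤ m := by exact_mod_cast Nat.one_le_floor_iff _ |>.2 hone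
      have h₂ := Nat.lt_floor_add_one (‖d k‖ / (2 * a))
      have h₃ : ‖d k‖ / (4 * a) = ‖d k‖ / (2 * a) / 2 := by field_simp; norm_num
      rw [h₃]
      linarith
    have hmk : (m : ℝ) ≤ M * k := by
      refine hm_le.trans ?_
      have h₁ : (k : ℝ) ^ (-1 : ℝ) ≤ (k : ℝ) ^ (-p) :=
        Real.rpow_le_rpow_of_exponent_le hk1 (by linarith)
      rw [Real.rpow_neg_one] at h₁
      rw [div_le_iff₀ (by positivity)]
      calc ‖d k‖ ≤ 2 * B := hd2 k
        _ = M * k * (2 * (A * (k : ℝ)⁻¹)) := by rw [hM]; field_simp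
        _ ≤ M * k * (2 * a) := by rw [ha]; gcongr
    set g : ℝ := c / ((c + 1 + M) * k) with hg
    have hfar := displacement_of_slowly_varying_direction (x := x) (d := d)
      (γ := fun j => c / (c + (j : ℝ))) (k := k) (m := m) (a := a) (g := g)
      (fun j hj => hx j (by omega)) hstep ha0.le
      (by
        rw [le_div_iff₀ (by positivity)] at hm_le
        linarith)
      (by positivity)
      (by
        intro j _ hj
        have hj' : (j : ℝ) ≤ k + m := by exact_mod_cast hj.le
        rw [hg]
        gcongr
        nlinarith)
    have hnear : ‖x (k + m) - x k‖ ≤ 2 * (R * (k : ℝ) ^ (-(q / 2))) := by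
      have h₁ := hdist k hk
      have h₂ := hdist (k + m) (by omega)
      have h₃ : ((k + m : ℕ) : ℝ) ^ (-(q / 2)) ≤ (k : ℝ) ^ (-(q / 2)) :=
        Real.rpow_le_rpow_of_nonpos hk0 (by push_cast; linarith [(m.cast_nonneg : (0:ℝ) ≤ m)])
          (by linarith)
      have h₄ := norm_sub_le_norm_sub_add_norm_sub (x (k + m)) xstar (x k)
      rw [norm_sub_rev xstar] at h₄
      have h₅ := mul_le_mul_of_nonneg_left h₃ (Real.sqrt_nonneg (4 * C₀ / μ))
      linarith
    have hkey : ‖d k‖ / (4 * a) * g * (‖d k‖ / 2) ≤ 2 * (R * (k : ℝ) ^ (-(q / 2))) :=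
      le_trans (by gcongr) (hfar.trans hnear)
    have hpow : (k : ℝ) ^ (-(q / 2 + p - 1)) = (k : ℝ) ^ (-(q / 2)) * (k : ℝ) ^ (-p) * k := by
      rw [← Real.rpow_add hk0, ← Real.rpow_add_one hk0.ne']
      congr 1; ring
    calc ‖d k‖ ^ 2
        = ‖d k‖ / (4 * a) * g * (‖d k‖ / 2) * (8 * a / g) := by
          have hg0 : 0 < g := by positivity
          field_simp
          ring
      _ ≤ 2 * (R * (k : ℝ) ^ (-(q / 2))) * (8 * a / g) := by gcongr
      _ = 16 * R * A * (c + 1 + M) / c * (k : ℝ) ^ (-(q / 2 + p - 1)) := by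
          rw [hpow, ha, hg]
          field_simp
          ring
      _ ≤ _ := by
        gcongr
        · exact le_add_of_nonneg_left (by positivity)
        · exact le_max_left _ _
end

section
/- Let c > 0, 0 < p < 1, r ∈ ℝ with c ≥ r − 1, C₁ > 0, and define α(t) = c^p·(c+t)^{1−p}/(1−p). Suppose g : [1,∞) → ℝ satisfies, for all t ≥ 1, g(t) ≤ − ∫₀ᵗ (e^{α(τ)}/e^{α(t)}) · ((c+τ)^c/(c+t)^c) · (C₁/(c+τ)^r) dτ. Then there exist a constant C₂ > 0 and t₀ ≥ 1 such that for all t ≥ t₀, g(t) ≤ − C₂·C₁·(c+t)^{1−r}/α(t). -/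
open MeasureTheory

/-- The function `exp (A x ^ s) * x ^ q` tends to infinity when `A` and `s` are positive. -/
theorem tendsto_exp_mul_rpow_mul_rpow_atTop {A s : ℝ} (hA : 0 < A) (hs : 0 < s) (q : ℝ) :
    Filter.Tendsto (fun x : ℝ => Real.exp (A * x ^ s) * x ^ q) Filter.atTop Filter.atTop := by
  have h := (tendsto_exp_mul_div_rpow_atTop (-q / s) A hA).comp (tendsto_rpow_atTop hs)
  refine h.congr' ?_
  filter_upwards [Filter.eventually_gt_atTop 0] with x hx
  simp only [Function.comp_apply]
  rw [← Real.rpow_mul hx.le, mul_div_cancel₀ _ hs.ne', Real.rpow_neg hx.le, div_inv_eq_mul]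

/-- Derivative of the comparison function `exp (A (c + τ) ^ (1 - p)) * (c + τ) ^ (m + p)`. -/
theorem hasDerivAt_exp_rpow_mul_rpow {c p A m τ : ℝ} (h : 0 < c + τ) :
    HasDerivAt (fun τ => Real.exp (A * (c + τ) ^ (1 - p)) * (c + τ) ^ (m + p))
      (Real.exp (A * (c + τ) ^ (1 - p)) * (c + τ) ^ m *
        (A * (1 - p) + (m + p) * (c + τ) ^ (p - 1))) τ := by
  have h0 : HasDerivAt (fun τ => c + τ) 1 τ := (hasDerivAt_id τ).const_add c
  have h1 := ((h0.rpow_const (p := 1 - p) (Or.inl h.ne')).const_mul A).exp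
  have h2 := h0.rpow_const (p := m + p) (Or.inl h.ne')
  refine (h1.mul h2).congr_deriv ?_
  have e1 : (c + τ) ^ (m + p) = (c + τ) ^ m * (c + τ) ^ p := Real.rpow_add h _ _
  have e2 : (c + τ) ^ (m + p - 1) = (c + τ) ^ m * (c + τ) ^ (p - 1) := by
    rw [← Real.rpow_add h]; congr 1; ring
  have e3 : (c + τ) ^ (1 - p - 1) * (c + τ) ^ p = 1 := by
    rw [← Real.rpow_add h]; simp
  rw [e1, e2]
  linear_combination Real.exp (A * (c + τ) ^ (1 - p)) * (c + τ) ^ m * A * (1 - p) * e3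

/-- Lower bound for `∫ exp (A (c + τ) ^ (1 - p)) * (c + τ) ^ m` by its leading asymptotics. -/
theorem exists_eventually_le_integral_exp_rpow_mul_rpow {c p A : ℝ} (m : ℝ) (hc : 0 < c)
    (hp : p < 1) (hA : 0 < A) :
    ∃ K > 0, ∀ᶠ t in Filter.atTop,
      K * (Real.exp (A * (c + t) ^ (1 - p)) * (c + t) ^ (m + p)) ≤
        ∫ τ in (0:ℝ)..t, Real.exp (A * (c + τ) ^ (1 - p)) * (c + τ) ^ m := by
  set F : ℝ → ℝ := fun τ => Real.exp (A * (c + τ) ^ (1 - p)) * (c + τ) ^ (m + p)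
  set M : ℝ := A * (1 - p) + |m + p| * c ^ (p - 1) with hM
  have hMpos : 0 < M := by
    have : 0 < 1 - p := by linarith
    positivity
  refine ⟨1 / (2 * M), by positivity, ?_⟩
  have htend : Filter.Tendsto F Filter.atTop Filter.atTop :=
    (tendsto_exp_mul_rpow_mul_rpow_atTop hA (sub_pos.2 hp) (m + p)).comp
      (Filter.tendsto_atTop_add_const_left _ c Filter.tendsto_id)
  filter_upwards [htend.eventually_ge_atTop (2 * F 0), Filter.eventually_ge_atTop 0] with t ht ht0
  have hpos : ∀ τ ∈ Set.uIcc 0 t, 0 < c + τ := fun τ hτ => by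
    rw [Set.uIcc_of_le ht0] at hτ
    linarith [hτ.1]
  have hcont : ∀ s : ℝ, ContinuousOn (fun τ => (c + τ) ^ s) (Set.uIcc 0 t) := fun s =>
    (continuousOn_const.add continuousOn_id).rpow_const fun τ hτ => Or.inl (hpos τ hτ).ne'
  have hcE : ContinuousOn (fun τ => Real.exp (A * (c + τ) ^ (1 - p)) * (c + τ) ^ m)
      (Set.uIcc 0 t) := (continuousOn_const.mul (hcont _)).rexp.mul (hcont _)
  have hcD : ContinuousOn (fun τ => Real.exp (A * (c + τ) ^ (1 - p)) * (c + τ) ^ m *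
      (A * (1 - p) + (m + p) * (c + τ) ^ (p - 1))) (Set.uIcc 0 t) :=
    hcE.mul (continuousOn_const.add (continuousOn_const.mul (hcont _)))
  have hftc := intervalIntegral.integral_eq_sub_of_hasDerivAt (f := F)
    (fun τ hτ => hasDerivAt_exp_rpow_mul_rpow (hpos τ hτ)) hcD.intervalIntegrable
  have hmono := intervalIntegral.integral_mono_on (μ := volume) ht0 hcD.intervalIntegrable
    (hcE.intervalIntegrable.mul_const M) (fun τ hτ => by
      have hτ' : 0 < c + τ := by linarith [hτ.1]
      refine mul_le_mul_of_nonneg_left ?_ (by positivity)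
      refine add_le_add_right (mul_le_mul (le_abs_self _) ?_ (by positivity) (abs_nonneg _)) _
      exact Real.rpow_le_rpow_of_nonpos hc (by linarith [hτ.1]) (by linarith))
  rw [hftc, intervalIntegral.integral_mul_const] at hmono
  rw [div_mul_eq_mul_div, one_mul, div_le_iff₀ (by positivity)]
  change F t ≤ _
  linarith

/-- Continuous energy-function decay: if `g` satisfies the integral inequality
with kernel `e^{α(τ)-α(t)} ((c+τ)/(c+t))^c` and source `C₁/(c+τ)^r`, where
`α(t) = c^p (c+t)^{1-p}/(1-p)`, then eventually
`g t ≤ -C₂ C₁ (c+t)^{1-r}/α(t)`. -/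
theorem continuous_energy_decay (c p r C₁ : ℝ) (hc : 0 < c) (hp0 : 0 < p)
    (hp1 : p < 1) (hcr : c ≥ r - 1) (hC₁ : 0 < C₁)
    (α : ℝ → ℝ) (hα : ∀ t, α t = c ^ p * (c + t) ^ (1 - p) / (1 - p))
    (g : ℝ → ℝ)
    (hg : ∀ t ≥ (1:ℝ), g t ≤
      -∫ τ in (0:ℝ)..t, (Real.exp (α τ) / Real.exp (α t)) *
        ((c + τ) ^ c / (c + t) ^ c) * (C₁ / (c + τ) ^ r)) :
    ∃ C₂ > 0, ∃ t₀ ≥ (1:ℝ), ∀ t ≥ t₀,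
      g t ≤ -(C₂ * C₁ * (c + t) ^ (1 - r) / α t) := by
  have hq : 0 < 1 - p := sub_pos.2 hp1
  have hcp : 0 < c ^ p := Real.rpow_pos_of_pos hc p
  set A : ℝ := c ^ p / (1 - p) with hA
  have hApos : 0 < A := div_pos hcp hq
  have hα' : ∀ t, α t = A * (c + t) ^ (1 - p) := fun t => by rw [hα, hA]; ring
  obtain ⟨K, hK, hev⟩ :=
    exists_eventually_le_integral_exp_rpow_mul_rpow (c - r) hc hp1 hApos
  obtain ⟨t₁, ht₁⟩ := Filter.eventually_atTop.1 hev
  refine ⟨K * A, by positivity, max 1 t₁, le_max_left _ _, fun t ht => ?_⟩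
  have ht1 : 1 ≤ t := (le_max_left _ _).trans ht
  have hx : 0 < c + t := by linarith
  refine (hg t ht1).trans (neg_le_neg ?_)
  have hint : (∫ τ in (0:ℝ)..t, (Real.exp (α τ) / Real.exp (α t)) *
        ((c + τ) ^ c / (c + t) ^ c) * (C₁ / (c + τ) ^ r)) =
      C₁ / (Real.exp (α t) * (c + t) ^ c) *
        ∫ τ in (0:ℝ)..t, Real.exp (A * (c + τ) ^ (1 - p)) * (c + τ) ^ (c - r) := by
    rw [← intervalIntegral.integral_const_mul]
    refine intervalIntegral.integral_congr fun τ hτ => ?_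
    rw [Set.uIcc_of_le (by linarith)] at hτ
    have hτ' : 0 < c + τ := by linarith [hτ.1]
    rw [← hα' τ, Real.rpow_sub hτ']
    field_simp
  rw [hint]
  refine le_trans (le_of_eq ?_) (mul_le_mul_of_nonneg_left (ht₁ t ((le_max_right _ _).trans ht))
    (by positivity))
  have e1 : (c + t) ^ (c - r + p) = (c + t) ^ c * (c + t) ^ (p - r) := by
    rw [← Real.rpow_add hx]; congr 1; ring
  have e2 : (c + t) ^ (1 - r) = (c + t) ^ (1 - p) * (c + t) ^ (p - r) := by
    rw [← Real.rpow_add hx]; congr 1; ring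
  rw [← hα' t, e1, e2, hα' t]
  field_simp
end

section
/- Let D ⊂ ℝⁿ be a compact convex set with ‖x‖₂ ≤ D_max for all x ∈ D, let f : ℝⁿ → ℝ be differentiable, and let x* ∈ D with S(x*) = argmin_{s∈D} ⟨∇f(x*), s⟩. Let c > 0, β_{t,τ} = c·(c+τ)^{c−1}/(c+t)^c, β̄_t = 1 − (c/(c+t))^c. Let s : [0,∞) → D be a measurable curve, let s̃(τ) be the point of the convex hull of S(x*) nearest (in Euclidean norm) to s(τ), and define s̄(t) = ∫₀ᵗ β_{t,τ}·s(τ) dτ and ŝ(t) = β̄_t^{−1}·∫₀ᵗ β_{t,τ}·s̃(τ) dτ. Suppose there is t̄ ≥ 1 such that s(τ) ∈ conv(S(x*)) for all τ ≥ t̄ (manifold identification). Then there exists a constant c₁ > 0 such that ‖s̄(t) − ŝ(t)‖₂ ≤ c₁/(c+t)^c for all t ≥ t̄. -/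
open MeasureTheory RealInnerProductSpace

lemma hasDerivAt_const_add_rpow {c τ : ℝ} (hc : 0 < c) (hτ : 0 ≤ τ) :
    HasDerivAt (fun x : ℝ => (c + x) ^ c) (c * (c + τ) ^ (c - 1)) τ := by
  have h := ((hasDerivAt_id τ).const_add c).rpow_const (p := c) (Or.inl (by simp; positivity))
  simpa using h

lemma intervalIntegrable_mul_const_add_rpow {c a b : ℝ} (hc : 0 < c) (ha : 0 ≤ a) (hb : 0 ≤ b) :
    IntervalIntegrable (fun τ : ℝ => c * (c + τ) ^ (c - 1)) volume a b := by
  refine ContinuousOn.intervalIntegrable fun τ hτ => ?_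
  have hτ0 : 0 ≤ τ := (le_min ha hb).trans hτ.1
  have : c + τ ≠ 0 := by positivity
  exact (((continuousAt_const.add continuousAt_id).rpow_const (Or.inl this)).const_mul
    c).continuousWithinAt

lemma integral_mul_const_add_rpow {c t : ℝ} (hc : 0 < c) (ht : 0 ≤ t) :
    ∫ τ in (0 : ℝ)..t, c * (c + τ) ^ (c - 1) = (c + t) ^ c - c ^ c := by
  rw [intervalIntegral.integral_eq_sub_of_hasDerivAt (f := fun x : ℝ => (c + x) ^ c)
    (fun τ hτ => hasDerivAt_const_add_rpow hc ((le_min le_rfl ht).trans hτ.1))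
    (intervalIntegrable_mul_const_add_rpow hc le_rfl ht)]
  simp

section Weighted

variable {E : Type*} [NormedAddCommGroup E] [NormedSpace ℝ E] {c M : ℝ} {u : ℝ → E}

lemma norm_mul_const_add_rpow_smul_le (hc : 0 < c) (hM : ∀ τ ≥ (0 : ℝ), ‖u τ‖ ≤ M) {τ : ℝ}
    (hτ : 0 ≤ τ) : ‖(c * (c + τ) ^ (c - 1)) • u τ‖ ≤ c * (c + τ) ^ (c - 1) * M := by
  have hw : 0 ≤ c * (c + τ) ^ (c - 1) := by positivity
  rw [norm_smul, Real.norm_of_nonneg hw]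
  exact mul_le_mul_of_nonneg_left (hM τ hτ) hw

lemma intervalIntegrable_mul_const_add_rpow_smul (hc : 0 < c) (hu : AEStronglyMeasurable u)
    (hM : ∀ τ ≥ (0 : ℝ), ‖u τ‖ ≤ M) {a b : ℝ} (ha : 0 ≤ a) (hb : 0 ≤ b) :
    IntervalIntegrable (fun τ => (c * (c + τ) ^ (c - 1)) • u τ) volume a b := by
  refine ((intervalIntegrable_mul_const_add_rpow hc ha hb).mul_const M).mono_fun' ?_ ?_
  · exact (Measurable.aestronglyMeasurable (by fun_prop)).smul hu.restrict
  · filter_upwards [ae_restrict_mem measurableSet_uIoc] with τ hτ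
    exact norm_mul_const_add_rpow_smul_le hc hM ((le_min ha hb).trans hτ.1.le)

lemma norm_integral_mul_const_add_rpow_smul_le (hc : 0 < c)
    (hM : ∀ τ ≥ (0 : ℝ), ‖u τ‖ ≤ M) {t : ℝ} (ht : 0 ≤ t) :
    ‖∫ τ in (0 : ℝ)..t, (c * (c + τ) ^ (c - 1)) • u τ‖ ≤ ((c + t) ^ c - c ^ c) * M := by
  rw [← integral_mul_const_add_rpow hc ht, ← intervalIntegral.integral_mul_const]
  exact intervalIntegral.norm_integral_le_of_norm_le ht
    (.of_forall fun τ hτ => norm_mul_const_add_rpow_smul_le hc hM hτ.1.le)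
    ((intervalIntegrable_mul_const_add_rpow hc le_rfl ht).mul_const M)

lemma integral_div_rpow_smul (t : ℝ) :
    ∫ τ in (0 : ℝ)..t, (c * (c + τ) ^ (c - 1) / (c + t) ^ c) • u τ =
      ((c + t) ^ c)⁻¹ • ∫ τ in (0 : ℝ)..t, (c * (c + τ) ^ (c - 1)) • u τ := by
  rw [← intervalIntegral.integral_smul]
  simp only [smul_smul, div_eq_inv_mul]

end Weighted

/-- Local averaging error of the averaged Frank-Wolfe flow (case `p = 1`): after
manifold identification at time `t̄` (all oracle outputs lie in the convex hull
of `S(x*)`), the averaged atom `s̄(t)` stays within `O(1/(c+t)^c)` of the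
normalized average `ŝ(t)` of the projected atoms. -/
theorem avgfw_flow_local_averaging_error (n : ℕ) (c Dmax : ℝ) (hc : 0 < c)
    (hDmax : 0 < Dmax)
    (D : Set (EuclideanSpace ℝ (Fin n))) (hDcomp : IsCompact D) (hDconv : Convex ℝ D)
    (hDbd : ∀ z ∈ D, ‖z‖ ≤ Dmax)
    (f : EuclideanSpace ℝ (Fin n) → ℝ)
    (f' : EuclideanSpace ℝ (Fin n) → EuclideanSpace ℝ (Fin n))
    (hgrad : ∀ z, HasGradientAt f (f' z) z)
    (xstar : EuclideanSpace ℝ (Fin n)) (hxstar : xstar ∈ D)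
    (S : Set (EuclideanSpace ℝ (Fin n)))
    (hS : S = {z ∈ D | ∀ y ∈ D, ⟪f' xstar, z⟫ ≤ ⟪f' xstar, y⟫})
    (s stilde : ℝ → EuclideanSpace ℝ (Fin n))
    (hsmeas : Measurable s) (hstmeas : Measurable stilde)
    (hsD : ∀ τ ≥ (0:ℝ), s τ ∈ D)
    (hstilde : ∀ τ ≥ (0:ℝ), stilde τ ∈ convexHull ℝ S ∧
      ∀ y ∈ convexHull ℝ S, ‖s τ - stilde τ‖ ≤ ‖s τ - y‖)
    (tbar : ℝ) (htbar : 1 ≤ tbar)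
    (hmani : ∀ τ ≥ tbar, s τ ∈ convexHull ℝ S)
    (sbar shat : ℝ → EuclideanSpace ℝ (Fin n))
    (hsbar : ∀ t, sbar t =
      ∫ τ in (0:ℝ)..t, (c * (c + τ) ^ (c - 1) / (c + t) ^ c) • s τ)
    (hshat : ∀ t, shat t = (1 - (c / (c + t)) ^ c)⁻¹ •
      ∫ τ in (0:ℝ)..t, (c * (c + τ) ^ (c - 1) / (c + t) ^ c) • stilde τ) :
    ∃ c₁ > 0, ∀ t ≥ tbar, ‖sbar t - shat t‖ ≤ c₁ / (c + t) ^ c := by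
  have hSD : convexHull ℝ S ⊆ D :=
    convexHull_min (by rw [hS]; exact fun z hz => hz.1) hDconv
  have hsM : ∀ τ ≥ (0 : ℝ), ‖s τ‖ ≤ Dmax := fun τ hτ => hDbd _ (hsD τ hτ)
  have hstM : ∀ τ ≥ (0 : ℝ), ‖stilde τ‖ ≤ Dmax := fun τ hτ => hDbd _ (hSD (hstilde τ hτ).1)
  have hs_eq : ∀ τ ≥ tbar, s τ = stilde τ := fun τ hτ => by
    simpa [sub_eq_zero] using (hstilde τ (by linarith)).2 _ (hmani τ hτ)
  set w : ℝ → ℝ := fun τ => c * (c + τ) ^ (c - 1)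
  have h0 : 0 ≤ tbar := by linarith
  have hIs {a b : ℝ} (ha : 0 ≤ a) (hb : 0 ≤ b) :
      IntervalIntegrable (fun τ => w τ • s τ) volume a b :=
    intervalIntegrable_mul_const_add_rpow_smul hc hsmeas.aestronglyMeasurable hsM ha hb
  have hIst {a b : ℝ} (ha : 0 ≤ a) (hb : 0 ≤ b) :
      IntervalIntegrable (fun τ => w τ • stilde τ) volume a b :=
    intervalIntegrable_mul_const_add_rpow_smul hc hstmeas.aestronglyMeasurable hstM ha hb
  set R := (∫ τ in (0 : ℝ)..tbar, w τ • s τ) - ∫ τ in (0 : ℝ)..tbar, w τ • stilde τ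
  refine ⟨‖R‖ + c ^ c * Dmax, by positivity, fun t ht => ?_⟩
  have ht0 : 0 < t := by linarith
  set J := ∫ τ in (0 : ℝ)..t, w τ • stilde τ
  have htail : ∫ τ in tbar..t, w τ • s τ = ∫ τ in tbar..t, w τ • stilde τ := by
    refine intervalIntegral.integral_congr fun τ hτ => ?_
    rw [Set.uIcc_of_le ht] at hτ
    simp only [hs_eq τ hτ.1]
  have hsplit : ∫ τ in (0 : ℝ)..t, w τ • s τ = R + J := by
    simp only [R, J]
    rw [← intervalIntegral.integral_add_adjacent_intervals (hIs le_rfl h0) (hIs h0 ht0.le),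
      ← intervalIntegral.integral_add_adjacent_intervals (hIst le_rfl h0) (hIst h0 ht0.le), htail]
    abel
  have hJ : ‖J‖ ≤ ((c + t) ^ c - c ^ c) * Dmax :=
    norm_integral_mul_const_add_rpow_smul_le hc hstM ht0.le
  have hcc : 0 < c ^ c := by positivity
  have hlt : c ^ c < (c + t) ^ c := Real.rpow_lt_rpow hc.le (by linarith) hc
  rw [hsbar, hshat, integral_div_rpow_smul, integral_div_rpow_smul,
    Real.div_rpow hc.le (by linarith)]
  change ‖((c + t) ^ c)⁻¹ • (∫ τ in (0 : ℝ)..t, w τ • s τ) -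
    (1 - c ^ c / (c + t) ^ c)⁻¹ • ((c + t) ^ c)⁻¹ • J‖ ≤ _
  rw [hsplit]
  generalize (c + t) ^ c = A at *
  generalize c ^ c = B at *
  have hA : 0 < A := hcc.trans hlt
  have hAB : 0 < A - B := sub_pos.2 hlt
  have hcoef : (1 - B / A)⁻¹ * A⁻¹ = A⁻¹ + A⁻¹ * (B / (A - B)) := by
    have : 1 - B / A = (A - B) / A := by field_simp
    rw [this]
    field_simp
    ring
  have hdiff : A⁻¹ • (R + J) - (1 - B / A)⁻¹ • A⁻¹ • J = A⁻¹ • (R - (B / (A - B)) • J) := by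
    rw [smul_smul, hcoef]
    module
  have hBJ : ‖(B / (A - B)) • J‖ ≤ B * Dmax := by
    rw [norm_smul, Real.norm_of_nonneg (by positivity)]
    calc B / (A - B) * ‖J‖ ≤ B / (A - B) * ((A - B) * Dmax) := by gcongr
      _ = B * Dmax := by field_simp
  rw [hdiff, norm_smul, Real.norm_of_nonneg (by positivity), div_eq_inv_mul _ A]
  refine mul_le_mul_of_nonneg_left ?_ (by positivity)
  exact (norm_sub_le _ _).trans (by gcongr)
end

section
/- Let c > 0, r > 0, C₃ ≥ 0, C ≥ 0, γ_k = c/(c+k), and let (h_k)_{k≥k̄} be a sequence of nonnegative reals satisfying h_{k+1} ≤ (1 − γ_k)·h_k + C₃/k^{c+1} + C/k^{r+2} for all k ≥ k̄ ≥ 1. Then there exists a constant C₄ > 0 such that for all k ≥ max(k̄, 2): h_k ≤ C₄·max(log(k)/(c+k)^c, 1/k^{r+1}). -/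
open Filter Topology in
/-- The homogeneous recursion `P (k+1) = k/(s+k) * P k` has a positive solution comparable to
`k ^ (-s)`. -/
theorem exists_homogeneous_solution_comparable_rpow {s : ℝ} (hs : 0 < s) :
    ∃ P : ℕ → ℝ, ∃ m > 0, ∃ M > 0, (∀ k, 0 < P k) ∧
      (∀ k : ℕ, 1 ≤ k → P (k + 1) = (k : ℝ) / (s + k) * P k) ∧
      ∀ k : ℕ, 1 ≤ k → m ≤ P k * (k : ℝ) ^ s ∧ P k * (k : ℝ) ^ s ≤ M := by
  let P : ℕ → ℝ := fun k => ((k - 1).factorial : ℝ) / ∏ j ∈ Finset.range k, (s + j)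
  have hprod : ∀ k : ℕ, 0 < ∏ j ∈ Finset.range k, (s + (j : ℝ)) :=
    fun k => Finset.prod_pos fun j _ => by positivity
  have hP : ∀ k, 0 < P k := fun k => div_pos (by positivity) (hprod k)
  have hlim : Tendsto (fun n : ℕ => P (n + 1) * ((n + 1 : ℕ) : ℝ) ^ s) atTop
      (𝓝 (Real.Gamma s)) := by
    have h1 : Tendsto (fun n : ℕ => Real.GammaSeq s (n + 1) * (1 + s * (1 / ((n : ℝ) + 1)))) atTop
        (𝓝 (Real.Gamma s * (1 + s * 0))) :=
      ((tendsto_add_atTop_iff_nat 1).2 (Real.GammaSeq_tendsto_Gamma s)).mul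
        ((tendsto_one_div_add_atTop_nhds_zero_nat.const_mul s).const_add 1)
    simp only [mul_zero, add_zero, mul_one] at h1
    refine h1.congr fun n => ?_
    have h2 := (hprod (n + 1)).ne'
    have h3 : s + ((n + 1 : ℕ) : ℝ) ≠ 0 := by positivity
    have h4 : (n : ℝ) + 1 ≠ 0 := by positivity
    simp only [Real.GammaSeq, P, Finset.prod_range_succ _ (n + 1), Nat.add_sub_cancel,
      Nat.factorial_succ n]
    push_cast at h3 ⊢
    field_simp
    ring
  have hpos : ∀ n : ℕ, 0 < P (n + 1) * ((n + 1 : ℕ) : ℝ) ^ s := fun n =>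
    mul_pos (hP _) (by positivity)
  obtain ⟨M, hM⟩ := hlim.bddAbove_range
  obtain ⟨N, hN⟩ := (hlim.inv₀ (Real.Gamma_pos_of_pos hs).ne').bddAbove_range
  have hM' : ∀ n : ℕ, P (n + 1) * ((n + 1 : ℕ) : ℝ) ^ s ≤ M := fun n => hM ⟨n, rfl⟩
  have hN' : ∀ n : ℕ, (P (n + 1) * ((n + 1 : ℕ) : ℝ) ^ s)⁻¹ ≤ N := fun n => hN ⟨n, rfl⟩
  have hNpos : 0 < N := (inv_pos.2 (hpos 0)).trans_le (hN' 0)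
  refine ⟨P, N⁻¹, inv_pos.2 hNpos, M, (hpos 0).trans_le (hM' 0), hP, ?_, ?_⟩
  · intro k hk
    obtain ⟨n, rfl⟩ := Nat.exists_eq_add_of_le' hk
    have h2 := (hprod (n + 1)).ne'
    have h3 : s + ((n + 1 : ℕ) : ℝ) ≠ 0 := by positivity
    simp only [P, Finset.prod_range_succ _ (n + 1), Nat.add_sub_cancel, Nat.factorial_succ n]
    push_cast at h3 ⊢
    field_simp
  · intro k hk
    obtain ⟨n, rfl⟩ := Nat.exists_eq_add_of_le' hk
    exact ⟨inv_le_of_inv_le₀ (hpos n) (hN' n), hM' n⟩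

/-- Solutions of the recursion with source `D / k ^ (s+1)` decay like `k ^ (-s)` when `s < c`. -/
theorem exists_le_div_rpow_of_recursion {c s D : ℝ} (hs : 0 < s) (hsc : s < c) (hD : 0 ≤ D)
    {K : ℕ} (hK : 1 ≤ K) {h : ℕ → ℝ} (hnn : 0 ≤ h K)
    (hrec : ∀ k : ℕ, K ≤ k → h (k + 1) ≤ (k : ℝ) / (c + k) * h k + D / (k : ℝ) ^ (s + 1)) :
    ∃ B ≥ 0, ∀ k : ℕ, K ≤ k → h k ≤ B * (1 / (k : ℝ) ^ s) := by
  obtain ⟨P, m, hm, M, hM, hP, hPrec, hPb⟩ := exists_homogeneous_solution_comparable_rpow hs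
  have hc : 0 < c := hs.trans hsc
  have hcs : 0 < c - s := sub_pos.2 hsc
  let A := h K / P K + D * ((1 + s) * (1 + c)) / ((c - s) * m)
  have hA : 0 ≤ A := add_nonneg (div_nonneg hnn (hP K).le) (by positivity)
  have key : ∀ k : ℕ, K ≤ k → h k ≤ A * P k := by
    intro k hk
    induction k, hk using Nat.le_induction with
    | base =>
      have : h K / P K * P K ≤ A * P K :=
        mul_le_mul_of_nonneg_right (le_add_of_nonneg_right (by positivity)) (hP K).le
      rwa [div_mul_cancel₀ _ (hP K).ne'] at this
    | succ k hk ih =>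
      have hk1 : 1 ≤ k := hK.trans hk
      have hk1' : (1 : ℝ) ≤ k := by exact_mod_cast hk1
      have hk0 : (0 : ℝ) < k := by linarith
      have hgap : (c - s) / ((1 + s) * (1 + c) * k) ≤ (k : ℝ) / (s + k) - k / (c + k) := by
        have e : (k : ℝ) / (s + k) - k / (c + k) = (c - s) * k / ((s + k) * (c + k)) := by
          field_simp
          ring
        rw [e, div_le_div_iff₀ (by positivity) (by positivity)]
        have : (s + k) * (c + k) ≤ ((1 + s) * k) * ((1 + c) * k) := by
          gcongr <;> nlinarith
        nlinarith [mul_le_mul_of_nonneg_left this hcs.le]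
      have hsrc : D / (k : ℝ) ^ (s + 1) ≤ A * P k * ((c - s) / ((1 + s) * (1 + c) * k)) := by
        have hA' : D * ((1 + s) * (1 + c)) / ((c - s) * m) ≤ A :=
          le_add_of_nonneg_left (div_nonneg hnn (hP K).le)
        have hPk : m / (k : ℝ) ^ s ≤ P k := (div_le_iff₀ (by positivity)).2 (hPb k hk1).1
        calc D / (k : ℝ) ^ (s + 1)
            = D * ((1 + s) * (1 + c)) / ((c - s) * m) * (m / (k : ℝ) ^ s)
                * ((c - s) / ((1 + s) * (1 + c) * k)) := by
              rw [Real.rpow_add_one hk0.ne']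
              field_simp
          _ ≤ _ := by gcongr
      have h1 := hrec k hk
      have h2 : (k : ℝ) / (c + k) * h k ≤ k / (c + k) * (A * P k) := by gcongr
      have h3 := mul_le_mul_of_nonneg_left hgap (mul_nonneg hA (hP k).le)
      rw [hPrec k hk1]
      linarith
  refine ⟨A * M, by positivity, fun k hk => (key k hk).trans ?_⟩
  have hk0 : (0 : ℝ) < k := by exact_mod_cast hK.trans hk
  have hPk : P k ≤ M / (k : ℝ) ^ s := (le_div_iff₀ (by positivity)).2 (hPb k (hK.trans hk)).2
  calc A * P k ≤ A * (M / (k : ℝ) ^ s) := by gcongr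
    _ = _ := by ring

/-- Solutions of the recursion with the resonant source `D / k ^ (c+1)` decay like
`log k / k ^ c`, up to a multiple of `1 / k ^ c`. -/
theorem exists_le_log_div_rpow_of_recursion {c D : ℝ} (hc : 0 < c) (hD : 0 ≤ D)
    {K : ℕ} (hK : 1 ≤ K) {h : ℕ → ℝ} (hnn : 0 ≤ h K)
    (hrec : ∀ k : ℕ, K ≤ k → h (k + 1) ≤ (k : ℝ) / (c + k) * h k + D / (k : ℝ) ^ (c + 1)) :
    ∃ A ≥ 0, ∃ B ≥ 0, ∀ k : ℕ, K ≤ k → h k ≤ (A + B * Real.log k) / (k : ℝ) ^ c := by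
  obtain ⟨P, m, hm, M, hM, hP, hPrec, hPb⟩ := exists_homogeneous_solution_comparable_rpow hc
  let A := h K / P K
  let B := 2 * D * (1 + c) / m
  have hA : 0 ≤ A := div_nonneg hnn (hP K).le
  have hB : 0 ≤ B := by positivity
  have key : ∀ k : ℕ, K ≤ k → h k ≤ (A + B * Real.log k) * P k := by
    intro k hk
    induction k, hk using Nat.le_induction with
    | base =>
      have hlog : 0 ≤ Real.log (K : ℝ) := Real.log_natCast_nonneg K
      have : A * P K ≤ (A + B * Real.log K) * P K :=
        mul_le_mul_of_nonneg_right (le_add_of_nonneg_right (by positivity)) (hP K).le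
      rwa [div_mul_cancel₀ _ (hP K).ne'] at this
    | succ k hk ih =>
      have hk1 : 1 ≤ k := hK.trans hk
      have hk1' : (1 : ℝ) ≤ k := by exact_mod_cast hk1
      have hk0 : (0 : ℝ) < k := by linarith
      have hlog : 1 / (2 * (k : ℝ)) ≤ Real.log ((k + 1 : ℕ) : ℝ) - Real.log k := by
        rw [← Real.log_div (by positivity) hk0.ne']
        refine le_trans ?_ (Real.one_sub_inv_le_log_of_pos (by positivity))
        have e : 1 - (((k + 1 : ℕ) : ℝ) / k)⁻¹ = 1 / ((k : ℝ) + 1) := by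
          push_cast
          field_simp
          ring
        rw [e]
        gcongr
        linarith
      have hfac : 1 / (1 + c) ≤ (k : ℝ) / (c + k) := by
        rw [div_le_div_iff₀ (by positivity) (by positivity)]
        nlinarith
      have hPk : m / (k : ℝ) ^ c ≤ P k := (div_le_iff₀ (by positivity)).2 (hPb k hk1).1
      have hsrc : D / (k : ℝ) ^ (c + 1) ≤
          B * (Real.log ((k + 1 : ℕ) : ℝ) - Real.log k) * ((k : ℝ) / (c + k) * P k) := by
        calc D / (k : ℝ) ^ (c + 1)
            = B * (1 / (2 * (k : ℝ))) * (1 / (1 + c) * (m / (k : ℝ) ^ c)) := by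
              rw [Real.rpow_add_one hk0.ne']
              simp only [B]
              field_simp
          _ ≤ _ := mul_le_mul (mul_le_mul_of_nonneg_left hlog hB) (by gcongr) (by positivity)
              (mul_nonneg hB (le_trans (by positivity) hlog))
      have h1 := hrec k hk
      have h2 : (k : ℝ) / (c + k) * h k ≤ k / (c + k) * ((A + B * Real.log k) * P k) := by gcongr
      rw [hPrec k hk1]
      linarith
  refine ⟨A * M, by positivity, B * M, by positivity, fun k hk => (key k hk).trans ?_⟩
  have hk0 : (0 : ℝ) < k := by exact_mod_cast hK.trans hk
  have hlog : 0 ≤ Real.log (k : ℝ) := Real.log_natCast_nonneg k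
  have hPk : P k ≤ M / (k : ℝ) ^ c := (le_div_iff₀ (by positivity)).2 (hPb k (hK.trans hk)).2
  calc (A + B * Real.log k) * P k ≤ (A + B * Real.log k) * (M / (k : ℝ) ^ c) := by gcongr
    _ = _ := by ring

/-- Discrete comparison recursion for the local convergence of the averaged
Frank-Wolfe method: if `h_{k+1} ≤ (1 - c/(c+k)) h_k + C₃/k^{c+1} + C/k^{r+2}`
for `k ≥ k̄`, then `h_k ≤ C₄ max(log k/(c+k)^c, 1/k^{r+1})` for all
`k ≥ max(k̄, 2)`. -/
theorem avgfw_local_comparison_recursion (c r C₃ C : ℝ) (hc : 0 < c)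
    (hr : 0 < r) (hC₃ : 0 ≤ C₃) (hC : 0 ≤ C)
    (kbar : ℕ) (hkbar : 1 ≤ kbar)
    (h : ℕ → ℝ) (hnn : ∀ k, 0 ≤ h k)
    (hrec : ∀ k : ℕ, kbar ≤ k →
      h (k + 1) ≤ (1 - c / (c + (k : ℝ))) * h k
        + C₃ / (k : ℝ) ^ (c + 1) + C / (k : ℝ) ^ (r + 2)) :
    ∃ C₄ > 0, ∀ k : ℕ, max kbar 2 ≤ k →
      h k ≤ C₄ * max (Real.log (k : ℝ) / (c + (k : ℝ)) ^ c) (1 / (k : ℝ) ^ (r + 1)) := by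
  have hfac : ∀ k : ℕ, kbar ≤ k → 1 - c / (c + (k : ℝ)) = k / (c + k) := by
    intro k _
    have : c + (k : ℝ) ≠ 0 := by positivity
    field_simp
    ring
  have hsource : ∀ t : ℝ, t ≤ c → t ≤ r + 1 → ∀ k : ℕ, kbar ≤ k →
      h (k + 1) ≤ (k : ℝ) / (c + k) * h k + (C₃ + C) / (k : ℝ) ^ (t + 1) := by
    intro t htc htr k hk
    have hk1 : (1 : ℝ) ≤ k := by exact_mod_cast hkbar.trans hk
    have hk0 : (0 : ℝ) < k := by linarith
    have h1 := hrec k hk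
    rw [hfac k hk] at h1
    have h2 : C₃ / (k : ℝ) ^ (c + 1) ≤ C₃ / (k : ℝ) ^ (t + 1) := by
      gcongr
    have h3 : C / (k : ℝ) ^ (r + 2) ≤ C / (k : ℝ) ^ (t + 1) := by
      exact div_le_div_of_nonneg_left hC (by positivity)
        (Real.rpow_le_rpow_of_exponent_le hk1 (by linarith))
    rw [add_div]
    linarith
  rcases lt_or_ge (r + 1) c with hrc | hcr
  · obtain ⟨B, hB, hle⟩ := exists_le_div_rpow_of_recursion (by linarith) hrc (add_nonneg hC₃ hC)
      hkbar (hnn kbar) (hsource (r + 1) hrc.le le_rfl)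
    refine ⟨B + 1, by positivity, fun k hk => ?_⟩
    calc h k ≤ B * (1 / (k : ℝ) ^ (r + 1)) := hle k ((le_max_left _ _).trans hk)
      _ ≤ (B + 1) * (1 / (k : ℝ) ^ (r + 1)) := by
        gcongr
        linarith
      _ ≤ _ := by
        gcongr
        exact le_max_right _ _
  · obtain ⟨A, hA, B, hB, hle⟩ := exists_le_log_div_rpow_of_recursion hc (add_nonneg hC₃ hC)
      hkbar (hnn kbar) (hsource c le_rfl hcr)
    have hlog2 : 0 < Real.log 2 := Real.log_pos one_lt_two
    refine ⟨(A / Real.log 2 + B + 1) * (1 + c) ^ c, by positivity, fun k hk => ?_⟩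
    have hk2 : (2 : ℝ) ≤ k := by exact_mod_cast (le_max_right _ _).trans hk
    have hk0 : (0 : ℝ) < k := by linarith
    have hlog : Real.log 2 ≤ Real.log k := Real.log_le_log two_pos hk2
    have hlogk : 0 < Real.log (k : ℝ) := hlog2.trans_le hlog
    have hA' : A ≤ A / Real.log 2 * Real.log k := by
      rw [div_mul_eq_mul_div, le_div_iff₀ hlog2]
      gcongr
    have hpow : (c + (k : ℝ)) ^ c ≤ (1 + c) ^ c * (k : ℝ) ^ c := by
      rw [← Real.mul_rpow (by positivity) hk0.le]
      gcongr
      nlinarith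
    calc h k ≤ (A + B * Real.log k) / (k : ℝ) ^ c := hle k ((le_max_left _ _).trans hk)
      _ ≤ ((A / Real.log 2 + B + 1) * Real.log k) / (k : ℝ) ^ c := by
        gcongr
        linarith
      _ = ((A / Real.log 2 + B + 1) * (1 + c) ^ c) *
            (Real.log k / ((1 + c) ^ c * (k : ℝ) ^ c)) := by
        field_simp
      _ ≤ ((A / Real.log 2 + B + 1) * (1 + c) ^ c) * (Real.log k / (c + (k : ℝ)) ^ c) := by
        gcongr
      _ ≤ _ := by
        gcongr
        exact le_max_left _ _
end

section
/- Let f : ℝⁿ → ℝ be differentiable, α > 0, and let B₁ = {x ∈ ℝⁿ : ‖x‖₁ ≤ α}. Let x* ∈ B₁ be such that: (a) there exists at least one index j with x*_j = 0; (b) every index j with x*_j ≠ 0 satisfies |∇f(x*)_j| = ‖∇f(x*)‖_∞; and (c) the degeneracy parameter δ := min over {j : x*_j = 0} of (‖∇f(x*)‖_∞ − |∇f(x*)_j|) is strictly positive. Let x ∈ ℝⁿ satisfy ‖∇f(x) − ∇f(x*)‖_∞ < δ/2. Then every extreme point s of B₁ that minimizes ⟨∇f(x), s⟩ over B₁ also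 minimizes ⟨∇f(x*), s⟩ over B₁. -/
open RealInnerProductSpace

/-- On the `ℓ₁`-ball of radius `α`, a linear functional whose coefficients are bounded by `G`
in absolute value is at least `-(G * α)`. -/
lemma neg_mul_le_inner_of_sum_abs_le {n : ℕ} {α G : ℝ} {g y : EuclideanSpace ℝ (Fin n)}
    (hG : 0 ≤ G) (hg : ∀ j, |g j| ≤ G) (hy : ∑ i, |y i| ≤ α) : -(G * α) ≤ ⟪g, y⟫ := by
  have h : ∀ j, -(G * |y j|) ≤ y j * g j := fun j => by
    have h₁ := mul_le_mul_of_nonneg_right (hg j) (abs_nonneg (y j))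
    have h₂ := neg_abs_le (y j * g j)
    rw [abs_mul] at h₂
    linarith
  have hsum : -(G * ∑ j, |y j|) ≤ ∑ j, y j * g j := by
    rw [Finset.mul_sum, ← Finset.sum_neg_distrib]
    exact Finset.sum_le_sum fun j _ => h j
  have hmul := mul_le_mul_of_nonneg_left hy hG
  simp only [PiLp.inner_apply, RCLike.inner_apply, conj_trivial]
  simp only [mul_comm (y _)] at hsum ⊢
  linarith

/-- Some vertex of the `ℓ₁`-ball along the `k`-th axis pairs with `g` to `-(|g k| * α)`. -/
lemma exists_sum_abs_le_inner_eq {n : ℕ} {α : ℝ} (hα : 0 ≤ α) (g : EuclideanSpace ℝ (Fin n))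
    (k : Fin n) :
    ∃ y : EuclideanSpace ℝ (Fin n), ∑ i, |y i| ≤ α ∧ ⟪g, y⟫ = -(|g k| * α) := by
  rcases abs_cases (g k) with ⟨h, _⟩ | ⟨h, _⟩
  · refine ⟨EuclideanSpace.single k (-α), ?_, ?_⟩
    · simp [apply_ite abs, abs_of_nonneg hα]
    · simp [EuclideanSpace.inner_single_right, h, mul_comm]
  · refine ⟨EuclideanSpace.single k α, ?_, ?_⟩
    · simp [apply_ite abs, abs_of_nonneg hα]
    · simp [EuclideanSpace.inner_single_right, h, mul_comm]

/-- Equality case of `neg_mul_le_inner_of_sum_abs_le`. -/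
lemma mul_eq_neg_mul_abs_of_inner_le {n : ℕ} {α G : ℝ} {g s : EuclideanSpace ℝ (Fin n)}
    (hG : 0 < G) (hg : ∀ j, |g j| ≤ G) (hs : ∑ i, |s i| ≤ α) (h : ⟪g, s⟫ ≤ -(G * α)) :
    ∑ i, |s i| = α ∧ ∀ j, g j * s j = -(G * |s j|) := by
  have hα : ∑ i, |s i| = α := by
    refine hs.antisymm (le_of_mul_le_mul_left ?_ hG)
    linarith [neg_mul_le_inner_of_sum_abs_le hG.le hg le_rfl (y := s)]
  have hnonneg : ∀ j ∈ Finset.univ, 0 ≤ g j * s j + G * |s j| := fun j _ => by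
    have h₁ := mul_le_mul_of_nonneg_right (hg j) (abs_nonneg (s j))
    have h₂ := neg_abs_le (g j * s j)
    rw [abs_mul] at h₂
    linarith
  have hsum : ∑ j, (g j * s j + G * |s j|) = 0 := by
    refine le_antisymm ?_ (Finset.sum_nonneg hnonneg)
    simp only [PiLp.inner_apply, RCLike.inner_apply, conj_trivial, mul_comm (s _)] at h
    rw [Finset.sum_add_distrib, ← Finset.mul_sum, hα]
    linarith
  refine ⟨hα, fun j => ?_⟩
  linarith [(Finset.sum_eq_zero_iff_of_nonneg hnonneg).mp hsum j (Finset.mem_univ j)]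

/-- Manifold-identification criterion for Frank-Wolfe over the ℓ₁-ball: if `x*`
satisfies the optimality condition that gradient coordinates on its support
attain the maximal absolute value `M = ‖∇f(x*)‖_∞`, the degeneracy parameter
`δ = min_{j : x*_j = 0} (M - |∇f(x*)_j|)` is positive, and
`‖∇f(x) - ∇f(x*)‖_∞ < δ/2`, then every extreme point of the ℓ₁-ball minimizing
`⟪∇f(x), ·⟫` also minimizes `⟪∇f(x*), ·⟫`. -/
theorem l1_manifold_identification (n : ℕ) (α : ℝ) (hα : 0 < α)
    (f : EuclideanSpace ℝ (Fin n) → ℝ)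
    (f' : EuclideanSpace ℝ (Fin n) → EuclideanSpace ℝ (Fin n))
    (hgrad : ∀ z, HasGradientAt f (f' z) z)
    (B₁ : Set (EuclideanSpace ℝ (Fin n)))
    (hB₁ : B₁ = {z : EuclideanSpace ℝ (Fin n) | ∑ i, |z i| ≤ α})
    (xstar : EuclideanSpace ℝ (Fin n)) (hxstar : xstar ∈ B₁)
    (M : ℝ) (hM : IsGreatest (Set.range fun j => |f' xstar j|) M)
    (ha : ∃ j, xstar j = 0)
    (hb : ∀ j, xstar j ≠ 0 → |f' xstar j| = M)
    (δ : ℝ) (hδ : IsLeast ((fun j => M - |f' xstar j|) '' {j | xstar j = 0}) δ)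
    (hδpos : 0 < δ)
    (x : EuclideanSpace ℝ (Fin n)) (hx : ∀ j, |f' x j - f' xstar j| < δ / 2) :
    ∀ s ∈ Set.extremePoints ℝ B₁,
      (∀ y ∈ B₁, ⟪f' x, s⟫ ≤ ⟪f' x, y⟫) →
      (∀ y ∈ B₁, ⟪f' xstar, s⟫ ≤ ⟪f' xstar, y⟫) := by
  subst hB₁
  intro s hext hmin y hy
  obtain ⟨j₀, hj₀⟩ := hM.1
  replace hj₀ : |f' xstar j₀| = M := hj₀
  have hle : ∀ j, |f' xstar j| ≤ M := fun j => hM.2 ⟨j, rfl⟩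
  have hgap : ∀ j, xstar j = 0 → δ ≤ M - |f' xstar j| := fun j hj => hδ.2 ⟨j, hj, rfl⟩
  have hδM : δ ≤ M := by
    obtain ⟨j, hj⟩ := ha
    linarith [hgap j hj, abs_nonneg (f' xstar j)]
  obtain ⟨k, -, hk⟩ := Finset.exists_max_image Finset.univ (fun j => |f' x j|)
    ⟨j₀, Finset.mem_univ j₀⟩
  have hk' : ∀ j, |f' x j| ≤ |f' x k| := fun j => hk j (Finset.mem_univ j)
  have hclose : ∀ j, |f' xstar j| - δ / 2 < |f' x j| ∧ |f' x j| < |f' xstar j| + δ / 2 :=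
    fun j => by
      have := abs_lt.mp ((abs_abs_sub_abs_le_abs_sub (f' x j) (f' xstar j)).trans_lt (hx j))
      constructor <;> linarith
  have hlarge : M - δ / 2 < |f' x k| := by linarith [(hclose j₀).1, hk' j₀]
  have hkpos : 0 < |f' x k| := by linarith
  obtain ⟨v, hv, hgv⟩ := exists_sum_abs_le_inner_eq hα.le (f' x) k
  have hs : ∑ i, |s i| ≤ α := hext.1
  obtain ⟨hsα, hcoord⟩ := mul_eq_neg_mul_abs_of_inner_le hkpos hk' hs ((hmin v hv).trans_eq hgv)
  have hcoord' : ∀ j, f' xstar j * s j = -(M * |s j|) := fun j => by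
    by_cases hsj : s j = 0
    · simp [hsj]
    have habs : |f' x j| = |f' x k| := by
      have h := congrArg abs (hcoord j)
      rw [abs_mul, abs_neg, abs_mul, abs_abs, abs_abs] at h
      exact mul_right_cancel₀ (abs_ne_zero.mpr hsj) h
    have hsupp : xstar j ≠ 0 := fun h0 => by linarith [hgap j h0, (hclose j).2]
    have hMj := hb j hsupp
    have hxj := abs_lt.mp (hx j)
    rcases abs_cases (f' xstar j) with ⟨h, _⟩ | ⟨h, _⟩
    · have hpos : 0 < f' x j := by linarith
      have hc := hcoord j
      rw [← habs, abs_of_pos hpos, ← mul_neg] at hc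
      rw [← h, hMj]
      linear_combination M * mul_left_cancel₀ hpos.ne' hc
    · have hneg : f' x j < 0 := by linarith
      have hc := hcoord j
      rw [← habs, abs_of_neg hneg, neg_mul, neg_neg] at hc
      have hM' : f' xstar j = -M := by linarith
      rw [hM']
      linear_combination -M * mul_left_cancel₀ hneg.ne hc
  have hval : ⟪f' xstar, s⟫ = -(M * α) := by
    simp only [PiLp.inner_apply, RCLike.inner_apply, conj_trivial, mul_comm (s _), hcoord']
    rw [Finset.sum_neg_distrib, ← Finset.mul_sum, hsα]
  rw [hval]
  exact neg_mul_le_inner_of_sum_abs_le (by linarith) hle hy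
end
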